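/- Let α ∈ [0,1) and N ∈ ℕ. Suppose a = (a₁,…,a_N) ∈ (ℝ\{0})^N satisfies Σ_{i ∈ P} a_i ≠ 0 for every nonempty subset P ⊂ {1,…,N}. Then there exists a set Z ⊂ (ℝ²)^N of 2N-dimensional Lebesgue measure zero, containing the generalized diagonal Δ_N = {(x₁,…,x_N) : x_i = x_j for some i ≠ j}, such that for every x⁰ ∈ (ℝ²)^N \ Z and every T > 0, there exists a (necessarily unique) solution of the α-point-vortex model on [0,T] with intensities a and initial configuration x⁰. -/

import Mathlib

open MeasureTheory Finset
noncomputable section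

abbrev E2 : Type := EuclideanSpace ℝ (Fin 2)

def perp (z : E2) : E2 := !₂[-(z 1), z 0]

def Cconst (α : ℝ) : ℝ :=
  Real.Gamma (α / 2) / (2 ^ ((2:ℝ) - α) * Real.pi * Real.Gamma ((2 - α) / 2))

def K (α : ℝ) (z : E2) : E2 := (-(α * Cconst α) / ‖z‖ ^ (α + 2)) • perp z

def IsPVSol (α : ℝ) {N : ℕ} (a : Fin N → ℝ) (x0 : Fin N → E2) (T : ℝ)
    (x : ℝ → Fin N → E2) : Prop :=
  ContinuousOn x (Set.Icc 0 T) ∧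
  (∀ t ∈ Set.Icc 0 T, ∀ i j : Fin N, i ≠ j → x t i ≠ x t j) ∧
  (∀ i : Fin N, ∀ t ∈ Set.Icc 0 T,
    x t i = x0 i + ∑ j ∈ Finset.univ.erase i, a j • (∫ s in (0:ℝ)..t, K α (x s i - x s j)))

/-- The Biot–Savart kernel for α ∈ [0,2): for α = 0 it is the Euler kernel
−(1/(2π)) z^⊥/|z|², and for α > 0 it is K_α. -/
def K' (α : ℝ) (z : E2) : E2 :=
  if α = 0 then (-(1 / (2 * Real.pi)) / ‖z‖ ^ (2:ℝ)) • perp z else K α z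

/-- Solution of the α-point-vortex model (allowing α = 0). -/
def IsPVSol' (α : ℝ) {N : ℕ} (a : Fin N → ℝ) (x0 : Fin N → E2) (T : ℝ)
    (x : ℝ → Fin N → E2) : Prop :=
  ContinuousOn x (Set.Icc 0 T) ∧
  (∀ t ∈ Set.Icc 0 T, ∀ i j : Fin N, i ≠ j → x t i ≠ x t j) ∧
  (∀ i : Fin N, ∀ t ∈ Set.Icc 0 T,
    x t i = x0 i + ∑ j ∈ Finset.univ.erase i, a j • (∫ s in (0:ℝ)..t, K' α (x s i - x s j)))

lemma pv_cluster_split {N : ℕ} (y : Fin N → E2) (Q : Finset (Fin N)) (i : Fin N) (hi : i ∈ Q)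
    (δ : ℝ) (hδ : 0 < δ) :
    (∀ j ∈ Q, ‖y j - y i‖ ≤ Q.card * δ) ∨
      ∃ S, S ⊂ Q ∧ i ∈ S ∧ ∀ j ∈ S, ∀ k ∈ Q, k ∉ S → δ ≤ ‖y j - y k‖ := by
  classical
  let F : Finset (Finset (Fin N)) :=
    Q.powerset.filter (fun S => i ∈ S ∧ ∀ j ∈ S, ‖y j - y i‖ ≤ S.card * δ)
  have hF : F.Nonempty := by
    refine ⟨{i}, ?_⟩
    simp [F, hi, hδ.le]
  obtain ⟨S, hS, hmax⟩ := F.exists_max_image (fun S => S.card) hF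
  simp only [F, Finset.mem_filter, Finset.mem_powerset] at hS hmax
  obtain ⟨hSQ, hiS, hSb⟩ := hS
  by_cases hEq : S = Q
  · left; subst hEq; exact hSb
  · right
    refine ⟨S, lt_of_le_of_ne hSQ hEq, hiS, fun j hj k hk hkS => ?_⟩
    by_contra hlt
    push Not at hlt
    have h1 : ∀ l ∈ insert k S, ‖y l - y i‖ ≤ (insert k S).card * δ := by
      intro l hl
      rw [Finset.card_insert_of_notMem hkS]
      push_cast
      rcases Finset.mem_insert.1 hl with rfl | hl
      · have : ‖y l - y i‖ ≤ ‖y j - y i‖ + ‖y j - y l‖ := by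
          have : y l - y i = (y j - y i) - (y j - y l) := by abel
          rw [this]; exact norm_sub_le _ _
        have := hSb j hj
        nlinarith
      · have := hSb l hl
        nlinarith
    have := hmax (insert k S) ⟨Finset.insert_subset hk hSQ, Finset.mem_insert_of_mem hiS, h1⟩
    rw [Finset.card_insert_of_notMem hkS] at this
    omega

lemma pv_min_sum {N : ℕ} (a : Fin N → ℝ)
    (hgen : ∀ P : Finset (Fin N), P.Nonempty → ∑ i ∈ P, a i ≠ 0) :
    ∃ m > 0, ∀ P : Finset (Fin N), P.Nonempty → m ≤ |∑ i ∈ P, a i| := by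
  classical
  by_cases h : (Finset.univ.filter (fun P : Finset (Fin N) => P.Nonempty)).Nonempty
  · obtain ⟨P0, hP0, hmin⟩ := Finset.exists_min_image _ (fun P => |∑ i ∈ P, a i|) h
    refine ⟨|∑ i ∈ P0, a i|, abs_pos.2 (hgen P0 (by simpa using hP0)), fun P hP => ?_⟩
    exact hmin P (by simpa using hP)
  · refine ⟨1, one_pos, fun P hP => ?_⟩
    exact absurd ⟨P, by simpa using hP⟩ h

/-- velocity field -/
def pvV {N : ℕ} (a : Fin N → ℝ) (k : E2 → E2) (x : Fin N → E2) : Fin N → E2 :=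
  fun i => ∑ j, a j • k (x i - x j)

lemma pv_center {N : ℕ} (a : Fin N → ℝ) (M : ℝ) (k : E2 → E2)
    (hodd : ∀ z, k (-z) = - k z) (hM : ∀ z, 1 ≤ ‖z‖ → ‖k z‖ ≤ M)
    (x : ℝ → Fin N → E2) (hx : ∀ t, HasDerivAt x (pvV a k (x t)) t)
    (Q : Finset (Fin N)) (s t : ℝ) (hst : s ≤ t)
    (hQ : ∀ u ∈ Set.Ico s t, ∀ i ∈ Q, ∀ j, j ∉ Q → 1 ≤ ‖x u i - x u j‖) :
    ‖∑ i ∈ Q, a i • x t i - ∑ i ∈ Q, a i • x s i‖ ≤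
      (∑ i ∈ Q, ∑ j ∈ Qᶜ, |a i| * |a j| * M) * (t - s) := by
  classical
  have hder : ∀ u, HasDerivAt (fun u => ∑ i ∈ Q, a i • x u i)
      (∑ i ∈ Q, a i • pvV a k (x u) i) u := by
    intro u
    have h := hasDerivAt_pi.1 (hx u)
    exact HasDerivAt.fun_sum fun i _ => (h i).const_smul (a i)
  have hbound : ∀ u ∈ Set.Ico s t, ‖∑ i ∈ Q, a i • pvV a k (x u) i‖ ≤
      ∑ i ∈ Q, ∑ j ∈ Qᶜ, |a i| * |a j| * M := by
    intro u hu
    have h0 : ∑ i ∈ Q, ∑ j ∈ Q, (a i * a j) • k (x u i - x u j) = 0 := by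
      have h1 : ∑ i ∈ Q, ∑ j ∈ Q, (a i * a j) • k (x u i - x u j)
          = - ∑ i ∈ Q, ∑ j ∈ Q, (a i * a j) • k (x u i - x u j) := by
        conv_lhs => rw [Finset.sum_comm]
        rw [← Finset.sum_neg_distrib]
        refine Finset.sum_congr rfl fun i _ => ?_
        rw [← Finset.sum_neg_distrib]
        refine Finset.sum_congr rfl fun j _ => ?_
        rw [← neg_sub (x u i) (x u j), hodd, smul_neg, mul_comm]
      have h2 : (2:ℝ) • ∑ i ∈ Q, ∑ j ∈ Q, (a i * a j) • k (x u i - x u j) = 0 := by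
        rw [two_smul]; nth_rewrite 1 [h1]; exact neg_add_cancel _
      exact (smul_eq_zero.1 h2).resolve_left two_ne_zero
    have h2 : ∑ i ∈ Q, a i • pvV a k (x u) i
        = ∑ i ∈ Q, ∑ j ∈ Qᶜ, (a i * a j) • k (x u i - x u j) := by
      have : ∀ i, a i • pvV a k (x u) i = ∑ j ∈ Q, (a i * a j) • k (x u i - x u j)
          + ∑ j ∈ Qᶜ, (a i * a j) • k (x u i - x u j) := by
        intro i
        rw [Finset.sum_add_sum_compl, pvV, Finset.smul_sum]
        simp only [smul_smul]
      simp only [this, Finset.sum_add_distrib, h0, zero_add]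
    rw [h2]
    refine (norm_sum_le _ _).trans (Finset.sum_le_sum fun i hi => ?_)
    refine (norm_sum_le _ _).trans (Finset.sum_le_sum fun j hj => ?_)
    rw [norm_smul, Real.norm_eq_abs, abs_mul]
    exact mul_le_mul_of_nonneg_left (hM _ (hQ u hu i hi j (by simpa using hj))) (by positivity)
  exact norm_image_sub_le_of_norm_deriv_right_le_segment
    (fun u _ => (hder u).continuousAt.continuousWithinAt)
    (fun u _ => (hder u).hasDerivWithinAt) hbound t ⟨hst, le_rfl⟩

lemma pv_bounded_aux {N : ℕ} (a : Fin N → ℝ)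
    (hgen : ∀ P : Finset (Fin N), P.Nonempty → ∑ i ∈ P, a i ≠ 0) (M T : ℝ) (hM0 : 0 ≤ M)
    (hT : 0 ≤ T) (n : ℕ) :
    ∃ C : ℝ, 0 ≤ C ∧ ∀ k : E2 → E2, (∀ z, k (-z) = - k z) → (∀ z, 1 ≤ ‖z‖ → ‖k z‖ ≤ M) →
      ∀ x : ℝ → Fin N → E2, (∀ t, HasDerivAt x (pvV a k (x t)) t) →
      ∀ Q : Finset (Fin N), Q.card ≤ n → ∀ s t : ℝ, s ≤ t → t - s ≤ T →
      (∀ u ∈ Set.Ico s t, ∀ i ∈ Q, ∀ j, j ∉ Q → 1 ≤ ‖x u i - x u j‖) →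
      ∀ i ∈ Q, ‖x t i - x s i‖ ≤ C := by
  classical
  obtain ⟨m, hm, hmP⟩ := pv_min_sum a hgen
  induction n with
  | zero =>
    refine ⟨0, le_rfl, ?_⟩
    intro k _ _ x _ Q hQ s t _ _ _ i hi
    have : Q = ∅ := by simpa using hQ
    simp [this] at hi
  | succ n ih =>
    obtain ⟨C, hC0, hC⟩ := ih
    set δ : ℝ := 2 + 2 * C with hδ
    have hδ0 : 0 < δ := by positivity
    set D : ℝ := 2 * ((n + 1) * δ) with hD
    set A : ℝ := ∑ i, |a i| with hA
    have hA0 : 0 ≤ A := Finset.sum_nonneg fun i _ => abs_nonneg _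
    set C1 : ℝ := (A * A * M * T + 2 * A * D) / m with hC1
    have hD0 : 0 ≤ D := by positivity
    have hC10 : 0 ≤ C1 := by positivity
    refine ⟨C + C1, by positivity, ?_⟩
    intro k hodd hM x hx Q hQn s t hst hstT hQ
    have hcont : Continuous x := continuous_iff_continuousAt.2 fun u => (hx u).continuousAt
    have hcontij : ∀ i j, Continuous fun u => ‖x u i - x u j‖ := fun i j => by fun_prop
    -- Claim 1
    have claim1 : ∀ u1 ∈ Set.Icc s t, ∀ u2 ∈ Set.Icc s t, u1 ≤ u2 →
        (∀ i ∈ Q, ∀ j ∈ Q, ‖x u1 i - x u1 j‖ ≤ D) → (∀ i ∈ Q, ∀ j ∈ Q, ‖x u2 i - x u2 j‖ ≤ D) →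
        ∀ i ∈ Q, ‖x u2 i - x u1 i‖ ≤ C1 := by
      intro u1 h1 u2 h2 h12 hd1 hd2 i hi
      have hc := pv_center a M k hodd hM x hx Q u1 u2 h12
        (fun u hu => hQ u ⟨h1.1.trans hu.1, hu.2.trans_le h2.2⟩)
      have hid : (∑ j ∈ Q, a j) • (x u2 i - x u1 i)
          = (∑ j ∈ Q, a j • x u2 j - ∑ j ∈ Q, a j • x u1 j)
            + ∑ j ∈ Q, a j • ((x u2 i - x u2 j) - (x u1 i - x u1 j)) := by
        rw [Finset.sum_smul, ← Finset.sum_sub_distrib, ← Finset.sum_add_distrib]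
        refine Finset.sum_congr rfl fun j _ => ?_
        simp only [smul_sub]; abel
      have hAQ : ∑ j ∈ Q, |a j| ≤ A :=
        Finset.sum_le_sum_of_subset_of_nonneg (Finset.subset_univ _) fun _ _ _ => abs_nonneg _
      have hAQ' : ∑ j ∈ Qᶜ, |a j| ≤ A :=
        Finset.sum_le_sum_of_subset_of_nonneg (Finset.subset_univ _) fun _ _ _ => abs_nonneg _
      have hn1 : ‖∑ j ∈ Q, a j • ((x u2 i - x u2 j) - (x u1 i - x u1 j))‖ ≤ A * (2 * D) := by
        refine (norm_sum_le _ _).trans ?_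
        calc ∑ j ∈ Q, ‖a j • ((x u2 i - x u2 j) - (x u1 i - x u1 j))‖
            ≤ ∑ j ∈ Q, |a j| * (2 * D) := by
              refine Finset.sum_le_sum fun j hj => ?_
              rw [norm_smul, Real.norm_eq_abs]
              refine mul_le_mul_of_nonneg_left ?_ (abs_nonneg _)
              refine (norm_sub_le _ _).trans ?_
              linarith [hd1 i hi j hj, hd2 i hi j hj]
          _ = (∑ j ∈ Q, |a j|) * (2 * D) := by rw [Finset.sum_mul]
          _ ≤ A * (2 * D) := by gcongr
      have hn2 : (∑ i ∈ Q, ∑ j ∈ Qᶜ, |a i| * |a j| * M) * (u2 - u1) ≤ A * A * M * T := by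
        have e : ∑ i ∈ Q, ∑ j ∈ Qᶜ, |a i| * |a j| * M
            = (∑ i ∈ Q, |a i|) * (∑ j ∈ Qᶜ, |a j|) * M := by
          rw [Finset.sum_mul_sum, Finset.sum_mul]
          simp only [Finset.sum_mul]
        rw [e]
        have : u2 - u1 ≤ T := by linarith [h1.1, h2.2]
        have h0 : 0 ≤ u2 - u1 := by linarith
        gcongr
      have hn3 : |∑ j ∈ Q, a j| * ‖x u2 i - x u1 i‖ ≤ A * A * M * T + 2 * A * D := by
        rw [← Real.norm_eq_abs, ← norm_smul, hid]
        refine (norm_add_le _ _).trans ?_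
        linarith
      rw [hC1, le_div_iff₀ hm]
      have := hmP Q ⟨i, hi⟩
      nlinarith [norm_nonneg (x u2 i - x u1 i)]
    -- Claim 2
    have claim2 : ∀ u ∈ Set.Icc s t, ¬ (∀ i ∈ Q, ∀ j ∈ Q, ‖x u i - x u j‖ ≤ D) →
        ∀ i ∈ Q, ‖x t i - x u i‖ ≤ C := by
      intro u hu hnot
      push Not at hnot
      obtain ⟨i0, hi0, j0, hj0, hij0⟩ := hnot
      have hsplit : ∃ S, S ⊂ Q ∧ i0 ∈ S ∧ ∀ j ∈ S, ∀ k ∈ Q, k ∉ S → δ ≤ ‖x u j - x u k‖ := by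
        rcases pv_cluster_split (x u) Q i0 hi0 δ hδ0 with h | h
        · exfalso
          have h1 := h j0 hj0
          have h3 : (Q.card : ℝ) * δ ≤ (n + 1) * δ := by
            have : (Q.card : ℝ) ≤ n + 1 := by exact_mod_cast hQn
            gcongr
          have h4 : (0:ℝ) < (n + 1) * δ := by positivity
          rw [norm_sub_rev] at hij0
          linarith
        · exact h
      obtain ⟨S, hSQ, hi0S, hS⟩ := hsplit
      have hcard1 : S.card ≤ n := by
        have := Finset.card_lt_card hSQ; omega
      have hcard2 : (Q \ S).card ≤ n := by
        have h1 := Finset.card_sdiff_add_card_eq_card hSQ.1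
        have h2 : 0 < S.card := Finset.card_pos.2 ⟨i0, hi0S⟩
        omega
      -- displacement while clusters are separated
      have key : ∀ w ∈ Set.Icc u t,
          (∀ v ∈ Set.Ico u w, ∀ i ∈ S, ∀ j ∈ Q, j ∉ S → 1 ≤ ‖x v i - x v j‖) →
          ∀ i ∈ Q, ‖x w i - x u i‖ ≤ C := by
        intro w hw hsep i hi
        have hQ' : ∀ v ∈ Set.Ico u w, ∀ i ∈ Q, ∀ j, j ∉ Q → 1 ≤ ‖x v i - x v j‖ :=
          fun v hv => hQ v ⟨hu.1.trans hv.1, hv.2.trans_le hw.2⟩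
        have hT' : w - u ≤ T := by linarith [hu.1, hw.2]
        by_cases hiS : i ∈ S
        · refine hC k hodd hM x hx S hcard1 u w hw.1 hT' ?_ i hiS
          intro v hv i hi j hj
          by_cases hjQ : j ∈ Q
          · exact hsep v hv i hi j hjQ hj
          · exact hQ' v hv i (hSQ.1 hi) j hjQ
        · refine hC k hodd hM x hx (Q \ S) hcard2 u w hw.1 hT' ?_ i
            (Finset.mem_sdiff.2 ⟨hi, hiS⟩)
          intro v hv i hi j hj
          rw [Finset.mem_sdiff] at hi hj
          by_cases hjQ : j ∈ Q
          · have hjS : j ∈ S := by by_contra h; exact hj ⟨hjQ, h⟩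
            rw [norm_sub_rev]
            exact hsep v hv j hjS i hi.1 hi.2
          · exact hQ' v hv i hi.1 j hjQ
      apply key t ⟨hu.2, le_rfl⟩
      let Bad : Set ℝ := Set.Icc u t ∩ ⋃ i ∈ S, ⋃ j ∈ Q \ S, {v | ‖x v i - x v j‖ ≤ 1}
      have hBadc : IsCompact Bad := by
        refine isCompact_Icc.inter_right ?_
        refine isClosed_biUnion_finset fun i _ => isClosed_biUnion_finset fun j _ => ?_
        exact isClosed_le (hcontij i j) continuous_const
      have hBade : ¬ Bad.Nonempty := by
        intro hne
        obtain ⟨w, hw, hwl⟩ := hBadc.exists_isLeast hne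
        have hsep : ∀ v ∈ Set.Ico u w, ∀ i ∈ S, ∀ j ∈ Q, j ∉ S → 1 ≤ ‖x v i - x v j‖ := by
          intro v hv i hi j hj hjS
          by_contra hlt
          push Not at hlt
          have : v ∈ Bad := by
            refine ⟨⟨hv.1, hv.2.le.trans hw.1.2⟩, ?_⟩
            simp only [Set.mem_iUnion]
            exact ⟨i, hi, j, Finset.mem_sdiff.2 ⟨hj, hjS⟩, hlt.le⟩
          exact absurd (hwl this) (not_le.2 hv.2)
        have hk := key w hw.1 hsep
        have hw2 := hw.2
        simp only [Set.mem_iUnion] at hw2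
        obtain ⟨i, hi, j, hj, hij⟩ := hw2
        rw [Finset.mem_sdiff] at hj
        have h1 := hS i hi j hj.1 hj.2
        have h2 := hk i (hSQ.1 hi)
        have h3 := hk j hj.1
        have h4 : x u i - x u j = (x w i - x w j) - (x w i - x u i) + (x w j - x u j) := by abel
        have h5 : ‖x u i - x u j‖ ≤ ‖x w i - x w j‖ + ‖x w i - x u i‖ + ‖x w j - x u j‖ := by
          rw [h4]
          exact (norm_add_le _ _).trans (by gcongr; exact norm_sub_le _ _)
        have h6 : ‖x w i - x w j‖ ≤ 1 := hij
        linarith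
      intro v hv i hi j hj hjS
      by_contra hlt
      push Not at hlt
      refine hBade ⟨v, ⟨hv.1, hv.2.le⟩, ?_⟩
      simp only [Set.mem_iUnion]
      exact ⟨i, hi, j, Finset.mem_sdiff.2 ⟨hj, hjS⟩, hlt.le⟩
    intro i hi
    by_cases hs : ∀ i ∈ Q, ∀ j ∈ Q, ‖x s i - x s j‖ ≤ D
    swap
    · have := claim2 s ⟨le_rfl, hst⟩ hs i hi
      linarith
    let U : Set ℝ := Set.Icc s t ∩ {u | ∀ i ∈ Q, ∀ j ∈ Q, ‖x u i - x u j‖ ≤ D}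
    have hUc : IsCompact U := by
      refine isCompact_Icc.inter_right ?_
      simp only [Set.ofPred_forall]
      exact isClosed_biInter fun i _ => isClosed_biInter fun j _ =>
        isClosed_le (hcontij i j) continuous_const
    obtain ⟨w, hw, hwg⟩ := hUc.exists_isGreatest ⟨s, ⟨le_rfl, hst⟩, hs⟩
    have e1 := claim1 s ⟨le_rfl, hst⟩ w hw.1 hw.1.1 hs hw.2 i hi
    have e2 : ‖x t i - x w i‖ ≤ C := by
      rcases hw.1.2.eq_or_lt with h | h
      · rw [h]; simpa using hC0
      · have hlim : Filter.Tendsto (fun u => ‖x t i - x u i‖) (nhdsWithin w (Set.Ioi w))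
            (nhds ‖x t i - x w i‖) := by
          have : Continuous (fun u => ‖x t i - x u i‖) := by fun_prop
          exact this.continuousAt.tendsto.mono_left nhdsWithin_le_nhds
        refine le_of_tendsto hlim ?_
        filter_upwards [Ioc_mem_nhdsGT h] with u hu
        refine claim2 u ⟨hw.1.1.trans hu.1.le, hu.2⟩ ?_ i hi
        intro hcon
        exact absurd (hwg (show u ∈ U from ⟨⟨hw.1.1.trans hu.1.le, hu.2⟩, hcon⟩)) (not_le.2 hu.1)
    have e3 : x t i - x s i = (x t i - x w i) + (x w i - x s i) := by abel
    rw [e3]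
    exact (norm_add_le _ _).trans (by linarith)

lemma pv_bounded {N : ℕ} (a : Fin N → ℝ)
    (hgen : ∀ P : Finset (Fin N), P.Nonempty → ∑ i ∈ P, a i ≠ 0) (M T : ℝ) (hM0 : 0 ≤ M)
    (hT : 0 ≤ T) :
    ∃ C : ℝ, 0 ≤ C ∧ ∀ k : E2 → E2, (∀ z, k (-z) = - k z) → (∀ z, 1 ≤ ‖z‖ → ‖k z‖ ≤ M) →
      ∀ x : ℝ → Fin N → E2, (∀ t, HasDerivAt x (pvV a k (x t)) t) →
      ∀ t ∈ Set.Icc 0 T, ∀ i, ‖x t i - x 0 i‖ ≤ C := by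
  obtain ⟨C, hC0, hC⟩ := pv_bounded_aux a hgen M T hM0 hT N
  refine ⟨C, hC0, fun k h1 h2 x hx t ht i => ?_⟩
  exact hC k h1 h2 x hx Finset.univ (by simp) 0 t ht.1 (by simpa using ht.2)
    (fun u _ i _ j hj => absurd (Finset.mem_univ j) hj) i (Finset.mem_univ i)

section flow
open Filter Topology
open scoped NNReal

lemma pv_exists_curve {E : Type*} [NormedAddCommGroup E] [NormedSpace ℝ E] [CompleteSpace E]
    (V : E → E) (Kc : ℝ≥0) (hV : LipschitzWith Kc V) (L : ℝ≥0) (hL : ∀ x, ‖V x‖ ≤ L) (x : E) :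
    ∃ f : ℝ → E, f 0 = x ∧ ∀ t, HasDerivAt f (V (f t)) t := by
  have hloc : ∀ n : ℕ, ∃ f : ℝ → E, f 0 = x ∧
      ∀ t ∈ Set.Ioo (-(n+1 : ℝ)) (n+1), HasDerivAt f (V (f t)) t := by
    intro n
    have h0 : (0:ℝ) ∈ Set.Icc (-(n+1 : ℝ)) (n+1) := ⟨by linarith [n.cast_nonneg (α := ℝ)], by positivity⟩
    have hPL : IsPicardLindelof (fun _ => V) (⟨0, h0⟩ : Set.Icc (-(n+1 : ℝ)) (n+1)) x
        (L * (n+1)) 0 L Kc := by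
      refine ⟨fun t _ => hV.lipschitzOnWith, fun y _ => continuousOn_const,
        fun t _ y _ => hL y, ?_⟩
      simp
    obtain ⟨f, hf0, hf⟩ := hPL.exists_eq_forall_mem_Icc_hasDerivWithinAt₀
    exact ⟨f, hf0, fun t ht => (hf t ⟨ht.1.le, ht.2.le⟩).hasDerivAt (Icc_mem_nhds ht.1 ht.2)⟩
  choose f hf0 hf using hloc
  have hagree : ∀ n m : ℕ, n ≤ m → ∀ t ∈ Set.Ioo (-(n+1 : ℝ)) (n+1), f n t = f m t := by
    intro n m hnm t ht
    have hnm' : (n:ℝ) ≤ m := by exact_mod_cast hnm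
    refine ODE_solution_unique_of_mem_Ioo (v := fun _ => V) (s := fun _ => Set.univ) (K := Kc)
      (t₀ := 0) (a := -(n+1 : ℝ)) (b := n+1)
      (fun _ _ => hV.lipschitzOnWith) ⟨by linarith [n.cast_nonneg (α := ℝ)], by positivity⟩
      (fun t ht => ⟨hf n t ht, trivial⟩)
      (fun t ht => ⟨hf m t ⟨by linarith [ht.1], by linarith [ht.2]⟩, trivial⟩)
      (by rw [hf0, hf0]) ht
  let g : ℝ → E := fun t => f ⌈|t|⌉₊ t
  have hg : ∀ n : ℕ, ∀ t ∈ Set.Ioo (-(n+1 : ℝ)) (n+1), g t = f n t := by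
    intro n t ht
    have h1 : t ∈ Set.Ioo (-((⌈|t|⌉₊ : ℝ)+1)) ((⌈|t|⌉₊ : ℝ)+1) := by
      have := Nat.le_ceil |t|
      constructor
      · linarith [neg_abs_le t]
      · linarith [le_abs_self t]
    rcases le_total ⌈|t|⌉₊ n with h | h
    · exact hagree _ _ h t h1
    · exact (hagree _ _ h t ht).symm
  refine ⟨g, by simp [g, hf0], fun t => ?_⟩
  have ht : t ∈ Set.Ioo (-((⌈|t|⌉₊ : ℝ)+1)) ((⌈|t|⌉₊ : ℝ)+1) := by
    have := Nat.le_ceil |t|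
    constructor
    · linarith [neg_abs_le t]
    · linarith [le_abs_self t]
  have h2 : g =ᶠ[𝓝 t] f ⌈|t|⌉₊ := by
    filter_upwards [Ioo_mem_nhds ht.1 ht.2] with u hu
    exact hg _ u hu
  rw [hg _ t ht]
  exact (hf _ t ht).congr_of_eventuallyEq h2

/-- Flow data. -/
structure PVFlow {E : Type*} [NormedAddCommGroup E] [NormedSpace ℝ E] (V : E → E)
    (φ : ℝ → E → E) : Prop where
  zero : ∀ x, φ 0 x = x
  deriv : ∀ x t, HasDerivAt (fun t => φ t x) (V (φ t x)) t

variable {E : Type*} [NormedAddCommGroup E] [NormedSpace ℝ E]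

lemma pv_exists_flow [CompleteSpace E]
    (V : E → E) (Kc : ℝ≥0) (hV : LipschitzWith Kc V) (L : ℝ≥0) (hL : ∀ x, ‖V x‖ ≤ L) :
    ∃ φ : ℝ → E → E, PVFlow V φ := by
  choose f hf0 hf using pv_exists_curve V Kc hV L hL
  exact ⟨fun t x => f x t, hf0, hf⟩

lemma PVFlow.add {V : E → E} {φ : ℝ → E → E} (h : PVFlow V φ) {Kc : ℝ≥0}
    (hV : LipschitzWith Kc V) (s t : ℝ) (x : E) : φ (s + t) x = φ s (φ t x) := by
  have := ODE_solution_unique_univ (v := fun _ => V) (s := fun _ => Set.univ) (K := Kc)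
    (f := fun s => φ (s + t) x) (g := fun s => φ s (φ t x)) (t₀ := 0)
    (fun _ => hV.lipschitzOnWith)
    (fun s => ⟨by simpa using (h.deriv x (s + t)).comp_add_const s t, trivial⟩)
    (fun s => ⟨h.deriv _ s, trivial⟩) (by simp [h.zero])
  exact congrFun this s

lemma PVFlow.lipschitz {V : E → E} {φ : ℝ → E → E} (h : PVFlow V φ) {Kc : ℝ≥0}
    (hV : LipschitzWith Kc V) (t : ℝ) (ht : 0 ≤ t) :
    LipschitzWith (Real.exp (Kc * t)).toNNReal (φ t) := by
  refine LipschitzWith.of_dist_le_mul fun x y => ?_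
  have := dist_le_of_trajectories_ODE (v := fun _ => V) (K := Kc) (f := fun t => φ t x)
    (g := fun t => φ t y) (a := 0) (b := t) (δ := dist x y) (fun _ => hV)
    (fun u _ => (h.deriv x u).continuousAt.continuousWithinAt)
    (fun u _ => (h.deriv x u).hasDerivWithinAt)
    (fun u _ => (h.deriv y u).continuousAt.continuousWithinAt)
    (fun u _ => (h.deriv y u).hasDerivWithinAt) (by simp [h.zero]) t ⟨ht, le_rfl⟩
  rw [Real.coe_toNNReal _ (Real.exp_pos _).le, mul_comm]
  simpa using this

lemma PVFlow.speed {V : E → E} {φ : ℝ → E → E} (h : PVFlow V φ) {L : ℝ≥0}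
    (hL : ∀ x, ‖V x‖ ≤ L) (s t : ℝ) (x : E) : ‖φ t x - φ s x‖ ≤ L * |t - s| := by
  have := convex_univ.norm_image_sub_le_of_norm_hasDerivWithin_le (f := fun t => φ t x)
    (f' := fun t => V (φ t x)) (C := L) (x := s) (y := t)
    (fun u _ => (h.deriv x u).hasDerivWithinAt) (fun u _ => hL _) trivial trivial
  simpa using this

lemma PVFlow.continuous {V : E → E} {φ : ℝ → E → E} (h : PVFlow V φ) {Kc : ℝ≥0}
    (hV : LipschitzWith Kc V) {L : ℝ≥0} (hL : ∀ x, ‖V x‖ ≤ L) :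
    Continuous fun p : ℝ × E => φ (max p.1 0) p.2 := by
  rw [continuous_iff_continuousAt]
  rintro ⟨t, x⟩
  rw [ContinuousAt, tendsto_iff_norm_sub_tendsto_zero]
  have hb : ∀ p : ℝ × E, ‖φ (max p.1 0) p.2 - φ (max t 0) x‖ ≤
      L * |max p.1 0 - max t 0| + Real.exp (Kc * max t 0) * ‖p.2 - x‖ := by
    intro p
    have h1 := h.speed hL (max t 0) (max p.1 0) p.2
    have h2 := (h.lipschitz hV (max t 0) (le_max_right _ _)).norm_sub_le p.2 x
    rw [Real.coe_toNNReal _ (Real.exp_pos _).le] at h2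
    have h3 : φ (max p.1 0) p.2 - φ (max t 0) x = (φ (max p.1 0) p.2 - φ (max t 0) p.2)
      + (φ (max t 0) p.2 - φ (max t 0) x) := by abel
    rw [h3]
    exact (norm_add_le _ _).trans (add_le_add h1 h2)
  refine squeeze_zero (fun p => norm_nonneg _) hb ?_
  have hc : Continuous fun p : ℝ × E =>
      L * |max p.1 0 - max t 0| + Real.exp (Kc * max t 0) * ‖p.2 - x‖ := by fun_prop
  simpa using hc.tendsto (t, x)

/-- Liouville for Lipschitz compactly supported test functions. -/
lemma PVFlow.integral_eq [FiniteDimensional ℝ E] [MeasurableSpace E] [BorelSpace E]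
    (μ : Measure E) [μ.IsAddHaarMeasure]
    {V : E → E} {φ : ℝ → E → E} (h : PVFlow V φ) {Kc : ℝ≥0}
    (hV : LipschitzWith Kc V) {L : ℝ≥0} (hL : ∀ x, ‖V x‖ ≤ L)
    {ι : Type*} [Fintype ι] (e : ι → E) (v : ι → E → ℝ) (D : ι → ℝ≥0)
    (hv : ∀ b, LipschitzWith (D b) (v b)) (hVv : ∀ x, V x = ∑ b, v b x • e b)
    (hdiv : ∀ x, ∑ b, lineDeriv ℝ (v b) x (e b) = 0)
    (f : E → ℝ) (Cf : ℝ≥0) (hf : LipschitzWith Cf f) (hfc : HasCompactSupport f)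
    (t : ℝ) (ht : 0 ≤ t) : ∫ x, f (φ t x) ∂μ = ∫ x, f x ∂μ := by
  -- supports
  have supp : ∀ (u : E → ℝ) (r : ℝ) (s : ℝ), 0 ≤ s → s ≤ r →
      ∀ x, x ∉ Metric.cthickening (L * r) (tsupport u) → u (φ s x) = 0 := by
    intro u r s hs hsr x hx
    rw [← Function.notMem_support]
    contrapose hx
    refine Metric.mem_cthickening_of_dist_le _ (φ s x) _ _ (subset_tsupport _ hx) ?_
    have := h.speed hL 0 s x
    rw [h.zero, sub_zero, abs_of_nonneg hs] at this
    rw [dist_comm, dist_eq_norm]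
    exact this.trans (by gcongr)
  have compsupp : ∀ (u : E → ℝ), HasCompactSupport u → ∀ s, 0 ≤ s →
      HasCompactSupport (fun x => u (φ s x)) := by
    intro u huc s hs
    exact HasCompactSupport.intro (IsCompact.cthickening (r := L * s) huc) (supp u s s hs le_rfl)
  have hφc : ∀ s, 0 ≤ s → Continuous (φ s) := fun s hs => (h.lipschitz hV s hs).continuous
  -- the infinitesimal statement
  have inf : ∀ (u : E → ℝ) (Cu : ℝ≥0), LipschitzWith Cu u → HasCompactSupport u →
      HasDerivWithinAt (fun s => ∫ x, u (φ s x) ∂μ) 0 (Set.Ici 0) 0 := by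
    intro u Cu hu huc
    have hzero : ∫ x, ∑ b, lineDeriv ℝ u x (e b) * v b x ∂μ = 0 := by
      have hint : ∀ b, Integrable (fun x => lineDeriv ℝ u x (e b) * v b x) μ := by
        intro b
        have h1 : IntegrableOn (fun x => lineDeriv ℝ u x (e b) * v b x) (tsupport u) μ :=
          ((hu.locallyIntegrable_lineDeriv (μ := μ) (e b)).integrableOn_isCompact huc).mul_continuousOn
            (hv b).continuous.continuousOn huc
        refine (integrableOn_iff_integrable_of_support_subset ?_).1 h1
        intro x hx
        by_contra hxs
        apply hx
        have h2 : u =ᶠ[𝓝 x] fun _ => 0 := notMem_tsupport_iff_eventuallyEq.1 hxs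
        have h3 : lineDeriv ℝ u x (e b) = 0 := by
          rw [h2.lineDeriv_eq]; simp [lineDeriv]
        simp [h3]
      rw [integral_finsetSum _ (fun b _ => hint b)]
      have h1 : ∀ b, ∫ x, lineDeriv ℝ u x (e b) * v b x ∂μ
          = - ∫ x, lineDeriv ℝ (v b) x (e b) * u x ∂μ := by
        intro b
        have := LipschitzWith.integral_lineDeriv_mul_eq (μ := μ) (hv b) hu huc (e b)
        rw [this, ← integral_neg]
        refine integral_congr_ae (ae_of_all _ fun x => ?_)
        simp [lineDeriv_neg]
      simp only [h1, Finset.sum_neg_distrib]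
      rw [← integral_finsetSum]
      · simp [← Finset.sum_mul, hdiv]
      · intro b _
        have := ((hv b).locallyIntegrable_lineDeriv (μ := μ)
          (e b)).integrable_smul_left_of_hasCompactSupport hu.continuous huc
        simpa [mul_comm] using this
    have hIci : Set.Ici (0:ℝ) \ {0} = Set.Ioi 0 := by
      ext r
      simp only [Set.mem_sdiff, Set.mem_Ici, Set.mem_singleton_iff, Set.mem_Ioi]
      exact ⟨fun h => lt_of_le_of_ne h.1 (Ne.symm h.2), fun h => ⟨h.le, h.ne'⟩⟩
    rw [hasDerivWithinAt_iff_tendsto_slope, hIci]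
    suffices hsuff : Tendsto (slope (fun s => ∫ x, u (φ s x) ∂μ) 0) (𝓝[>] 0)
        (𝓝 (∫ x, ∑ b, lineDeriv ℝ u x (e b) * v b x ∂μ)) by rwa [hzero] at hsuff
    have hslope : ∀ᶠ s in 𝓝[>] (0:ℝ), ∫ x, s⁻¹ * (u (φ s x) - u x) ∂μ
        = slope (fun s => ∫ x, u (φ s x) ∂μ) 0 s := by
      filter_upwards [self_mem_nhdsWithin] with s hs
      have hs : 0 < s := hs
      rw [slope_def_module, sub_zero, smul_eq_mul, integral_const_mul, integral_sub]
      · simp [h.zero]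
      · exact (hu.continuous.comp (hφc s hs.le)).integrable_of_hasCompactSupport
          (compsupp u huc s hs.le)
      · exact hu.continuous.integrable_of_hasCompactSupport huc
    refine Tendsto.congr' hslope ?_
    have hKc : IsCompact (Metric.cthickening (L * (1:ℝ)) (tsupport u)) := IsCompact.cthickening huc
    refine tendsto_integral_filter_of_dominated_convergence
      ((Metric.cthickening (L * (1:ℝ)) (tsupport u)).indicator fun _ => (Cu * L : ℝ)) ?_ ?_ ?_ ?_
    · filter_upwards [self_mem_nhdsWithin] with s hs
      have hs : 0 < s := hs
      exact (continuous_const.mul ((hu.continuous.comp (hφc s hs.le)).sub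
        hu.continuous)).aestronglyMeasurable
    · filter_upwards [Ioc_mem_nhdsGT zero_lt_one] with s hs
      refine ae_of_all _ fun x => ?_
      by_cases hx : x ∈ Metric.cthickening (L * (1:ℝ)) (tsupport u)
      · rw [Set.indicator_of_mem hx, norm_mul, norm_inv, Real.norm_eq_abs s, abs_of_pos hs.1,
          inv_mul_le_iff₀ hs.1]
        have h1 := hu.norm_sub_le (φ s x) x
        have h2 := h.speed hL 0 s x
        rw [h.zero, sub_zero, abs_of_pos hs.1] at h2
        calc _ ≤ _ := h1
          _ ≤ Cu * (L * s) := by gcongr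
          _ = _ := by ring
      · have e1 := supp u 1 s hs.1.le hs.2 x hx
        have e2 := supp u 1 0 le_rfl zero_le_one x hx
        rw [h.zero] at e2
        rw [Set.indicator_of_notMem hx, e1, e2]
        simp
    · rw [integrable_indicator_iff hKc.measurableSet]
      exact integrableOn_const hKc.measure_lt_top.ne
    · filter_upwards [hu.ae_differentiableAt (μ := μ)] with x hx
      have h1 : HasDerivAt (fun s => u (φ s x)) (fderiv ℝ u x (V x)) 0 := by
        have h2 := h.deriv x 0
        have h3 : HasFDerivAt u (fderiv ℝ u x) (φ 0 x) := by rw [h.zero]; exact hx.hasFDerivAt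
        have := h3.comp_hasDerivAt (0:ℝ) h2
        rw [h.zero] at this
        exact this
      have h4 := h1.tendsto_slope_zero_right
      have h5 : fderiv ℝ u x (V x) = ∑ b, lineDeriv ℝ u x (e b) * v b x := by
        rw [hVv, map_sum]
        refine Finset.sum_congr rfl fun b _ => ?_
        rw [map_smul, hx.lineDeriv_eq_fderiv, smul_eq_mul, mul_comm]
      rw [h5] at h4
      simpa [h.zero] using h4
  have hder : ∀ s ∈ Set.Ico 0 t, HasDerivWithinAt (fun s => ∫ x, f (φ s x) ∂μ) 0 (Set.Ici s) s := by
    intro s hs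
    have h1 := inf (fun x => f (φ s x)) _ (hf.comp (h.lipschitz hV s hs.1)) (compsupp f hfc s hs.1)
    have h2 : HasDerivWithinAt (fun r : ℝ => r - s) 1 (Set.Ici s) s :=
      (hasDerivWithinAt_id s _).sub_const s
    have h1' : HasDerivWithinAt (fun r => ∫ x, f (φ s (φ r x)) ∂μ) 0 (Set.Ici 0) (s - s) := by
      rw [sub_self]; exact h1
    have h3 := HasDerivWithinAt.comp (h := fun r : ℝ => r - s) (s' := Set.Ici 0) s h1' h2
      (fun r hr => Set.mem_Ici.2 (sub_nonneg.2 hr))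
    rw [zero_mul] at h3
    refine h3.congr_of_mem (fun r _ => ?_) (Set.mem_Ici.2 le_rfl)
    simp only [Function.comp]
    refine integral_congr_ae (ae_of_all _ fun x => ?_)
    simp only
    rw [← h.add hV, add_sub_cancel]
  have hcont : ContinuousOn (fun s => ∫ x, f (φ s x) ∂μ) (Set.Icc 0 t) := by
    have hKc : IsCompact (Metric.cthickening (L * t) (tsupport f)) := IsCompact.cthickening hfc
    obtain ⟨B, hB⟩ := hfc.exists_bound_of_continuous hf.continuous
    refine continuousOn_of_dominated
      (bound := (Metric.cthickening (L * t) (tsupport f)).indicator fun _ => B) ?_ ?_ ?_ ?_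
    · intro s hs
      exact (hf.continuous.comp (hφc s hs.1)).aestronglyMeasurable
    · intro s hs
      refine ae_of_all _ fun x => ?_
      by_cases hx : x ∈ Metric.cthickening (L * t) (tsupport f)
      · rw [Set.indicator_of_mem hx]; exact hB _
      · rw [Set.indicator_of_notMem hx, supp f t s hs.1 hs.2 x hx]; simp
    · rw [integrable_indicator_iff hKc.measurableSet]
      exact integrableOn_const hKc.measure_lt_top.ne
    · refine ae_of_all _ fun x => ?_
      exact fun s _ => (hf.continuous.continuousAt.comp
        (h.deriv x s).continuousAt).continuousWithinAt
  have := constant_of_has_deriv_right_zero hcont hder t ⟨ht, le_rfl⟩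
  simpa [h.zero] using this

lemma PVFlow.measurePreserving [FiniteDimensional ℝ E] [MeasurableSpace E] [BorelSpace E]
    (μ : Measure E) [μ.IsAddHaarMeasure]
    {V : E → E} {φ : ℝ → E → E} (h : PVFlow V φ) {Kc : ℝ≥0}
    (hV : LipschitzWith Kc V) {L : ℝ≥0} (hL : ∀ x, ‖V x‖ ≤ L)
    {ι : Type*} [Fintype ι] (e : ι → E) (v : ι → E → ℝ) (D : ι → ℝ≥0)
    (hv : ∀ b, LipschitzWith (D b) (v b)) (hVv : ∀ x, V x = ∑ b, v b x • e b)
    (hdiv : ∀ x, ∑ b, lineDeriv ℝ (v b) x (e b) = 0)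
    (t : ℝ) (ht : 0 ≤ t) : MeasurePreserving (φ t) μ μ := by
  have hφc : Continuous (φ t) := (h.lipschitz hV t ht).continuous
  refine ⟨hφc.measurable, ?_⟩
  have : ProperSpace E := FiniteDimensional.proper ℝ E
  -- preimages of compacts are in compacts
  have hpre : ∀ A : Set E, φ t ⁻¹' A ⊆ Metric.cthickening (L * t) A := by
    intro A x hx
    refine Metric.mem_cthickening_of_dist_le _ (φ t x) _ _ hx ?_
    have := h.speed hL 0 t x
    rw [h.zero, sub_zero, abs_of_nonneg ht] at this
    rwa [dist_comm, dist_eq_norm]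
  have hK : ∀ A : Set E, IsCompact A → μ.map (φ t) A = μ A := by
    intro A hA
    rw [Measure.map_apply hφc.measurable hA.measurableSet]
    let δ : ℕ → ℝ := fun n => 1 / ((n:ℝ) + 1)
    have hδ : ∀ n, 0 < δ n := fun n => by positivity
    have hδ1 : ∀ n, δ n ≤ 1 := fun n => by
      simp only [δ]; rw [div_le_one (by positivity)]; linarith [n.cast_nonneg (α := ℝ)]
    have hδl : Tendsto δ atTop (𝓝 0) := tendsto_one_div_add_atTop_nhds_zero_nat
    let f : ℕ → E → ℝ := fun n x => (thickenedIndicator (hδ n) A x : ℝ)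
    have hfl : ∀ n, LipschitzWith (δ n).toNNReal⁻¹ (f n) := fun n => by
      have := lipschitzWith_thickenedIndicator (hδ n) A
      exact this
    have hfz : ∀ n, ∀ x, x ∉ Metric.cthickening 1 A → f n x = 0 := by
      intro n x hx
      have : x ∉ Metric.thickening (δ n) A := fun h =>
        hx (Metric.thickening_subset_cthickening_of_le (hδ1 n) A h)
      show ((thickenedIndicator (hδ n) A x : ℝ≥0):ℝ) = 0
      rw [thickenedIndicator_zero (hδ n) A this]; rfl
    have hfc : ∀ n, HasCompactSupport (f n) := fun n =>
      HasCompactSupport.intro (IsCompact.cthickening (r := 1) hA) (hfz n)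
    have hf1 : ∀ n x, ‖f n x‖ ≤ 1 := by
      intro n x
      rw [Real.norm_of_nonneg (NNReal.coe_nonneg _)]
      exact_mod_cast thickenedIndicator_le_one (hδ n) A x
    have hlim : ∀ x, Tendsto (fun n => f n x) atTop (𝓝 (A.indicator (fun _ => (1:ℝ)) x)) := by
      intro x
      have h1 := thickenedIndicator_tendsto_indicator_closure hδ hδl A
      rw [tendsto_pi_nhds] at h1
      have h2 := (NNReal.continuous_coe.tendsto _).comp (h1 x)
      rw [hA.isClosed.closure_eq] at h2
      have e : ((A.indicator (fun _ => (1:ℝ≥0)) x : ℝ≥0):ℝ) = A.indicator (fun _ => (1:ℝ)) x := by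
        by_cases hx : x ∈ A <;> simp [Set.indicator, hx]
      rw [e] at h2
      exact h2
    have hc1 : IsCompact (Metric.cthickening 1 A) := IsCompact.cthickening hA
    have l1 : Tendsto (fun n => ∫ x, f n x ∂μ) atTop (𝓝 (∫ x, A.indicator (fun _ => (1:ℝ)) x ∂μ)) := by
      refine tendsto_integral_of_dominated_convergence
        ((Metric.cthickening 1 A).indicator fun _ => (1:ℝ)) ?_ ?_ ?_ ?_
      · exact fun n => (hfl n).continuous.aestronglyMeasurable
      · rw [integrable_indicator_iff hc1.measurableSet]
        exact integrableOn_const hc1.measure_lt_top.ne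
      · intro n
        refine ae_of_all _ fun x => ?_
        by_cases hx : x ∈ Metric.cthickening 1 A
        · rw [Set.indicator_of_mem hx]; exact hf1 n x
        · rw [Set.indicator_of_notMem hx, hfz n x hx]; simp
      · exact ae_of_all _ hlim
    have hc2 : IsCompact (Metric.cthickening (L * t) (Metric.cthickening 1 A)) :=
      IsCompact.cthickening hc1
    have l2 : Tendsto (fun n => ∫ x, f n (φ t x) ∂μ) atTop
        (𝓝 (∫ x, A.indicator (fun _ => (1:ℝ)) (φ t x) ∂μ)) := by
      refine tendsto_integral_of_dominated_convergence
        ((Metric.cthickening (L * t) (Metric.cthickening 1 A)).indicator fun _ => (1:ℝ)) ?_ ?_ ?_ ?_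
      · exact fun n => ((hfl n).continuous.comp hφc).aestronglyMeasurable
      · rw [integrable_indicator_iff hc2.measurableSet]
        exact integrableOn_const hc2.measure_lt_top.ne
      · intro n
        refine ae_of_all _ fun x => ?_
        by_cases hx : x ∈ Metric.cthickening (L * t) (Metric.cthickening 1 A)
        · rw [Set.indicator_of_mem hx]; exact hf1 n _
        · rw [Set.indicator_of_notMem hx, hfz n (φ t x) (fun h' => hx (hpre _ h'))]; simp
      · exact ae_of_all _ fun x => hlim _
    have heq : ∀ n, ∫ x, f n (φ t x) ∂μ = ∫ x, f n x ∂μ := fun n =>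
      h.integral_eq μ hV hL e v D hv hVv hdiv (f n) _ (hfl n) (hfc n) t ht
    simp only [heq] at l2
    have := tendsto_nhds_unique l2 l1
    have hm : MeasurableSet (φ t ⁻¹' A) := hφc.measurable hA.measurableSet
    have e1 : (fun x => A.indicator (fun _ => (1:ℝ)) (φ t x))
        = (φ t ⁻¹' A).indicator (fun _ => (1:ℝ)) := by
      ext x; by_cases hx : φ t x ∈ A
      · rw [Set.indicator_of_mem hx, Set.indicator_of_mem (by exact hx)]
      · rw [Set.indicator_of_notMem hx, Set.indicator_of_notMem (by exact hx)]
    rw [e1, integral_indicator_const _ hm, integral_indicator_const _ hA.measurableSet] at this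
    simp only [smul_eq_mul, mul_one, Measure.real] at this
    have fin1 : μ (φ t ⁻¹' A) ≠ ⊤ :=
      ((measure_mono (hpre A)).trans_lt (IsCompact.cthickening (r := L * t) hA).measure_lt_top).ne
    exact (ENNReal.toReal_eq_toReal_iff' fin1 hA.measure_lt_top.ne).1 this
  have : IsFiniteMeasureOnCompacts (μ.map (φ t)) := ⟨fun A hA => by
    rw [hK A hA]; exact hA.measure_lt_top⟩
  refine Measure.OuterRegular.ext_isOpen fun U hU => ?_
  rw [hU.measure_eq_iSup_isCompact, hU.measure_eq_iSup_isCompact]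
  congr! 4 with A _ hA
  exact hK A hA
end flow


section kernel
open Filter Topology
open scoped NNReal

lemma pv_perp_zero (z : E2) : perp z 0 = - z 1 := by simp [perp]
lemma pv_perp_one (z : E2) : perp z 1 = z 0 := by simp [perp]

def pvP : E2 →L[ℝ] E2 := LinearMap.toContinuousLinearMap
  { toFun := perp
    map_add' := fun x y => by
      ext m; fin_cases m
      · simp [pv_perp_zero]; ring
      · simp [pv_perp_one]
    map_smul' := fun r x => by
      ext m; fin_cases m
      · simp [pv_perp_zero]
      · simp [pv_perp_one] }

lemma pvP_apply (z : E2) : pvP z = perp z := rfl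

lemma pv_norm_perp (z : E2) : ‖perp z‖ = ‖z‖ := by
  rw [EuclideanSpace.norm_eq, EuclideanSpace.norm_eq]
  simp only [Fin.sum_univ_two, pv_perp_zero, pv_perp_one, norm_neg]
  rw [add_comm]

lemma pv_inner (x y : E2) : inner ℝ x y = x 0 * y 0 + x 1 * y 1 := by
  rw [PiLp.inner_apply]; simp [Fin.sum_univ_two]; ring

lemma pv_inner_perp (z : E2) : inner ℝ z (perp z) = 0 := by
  rw [pv_inner, pv_perp_zero, pv_perp_one]; ring

/-- A regularised kernel. -/
structure PVKer (α c ε R : ℝ) (k : E2 → E2) : Prop where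
  smooth : ContDiff ℝ 1 k
  supp : HasCompactSupport k
  odd : ∀ z, k (-z) = - k z
  orth : ∀ z, inner ℝ z (k z) = 0
  bound : ∀ z, ‖k z‖ ≤ |c| * ‖z‖ ^ (-(1 + α))
  eq : ∀ z, ε ≤ ‖z‖ ^ 2 → ‖z‖ ^ 2 ≤ R → k z = (c / ‖z‖ ^ (α + 2)) • perp z
  div : ∀ z, ∑ m : Fin 2, (fderiv ℝ k z (EuclideanSpace.single m 1)) m = 0

lemma pv_exists_ker (α c ε R : ℝ) (hα : 0 ≤ α) (hε : 0 < ε) (hR : ε < R) :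
    ∃ k, PVKer α c ε R k := by
  let χ : ContDiffBump ((ε + R) / 2) :=
    { rIn := (R - ε) / 2, rOut := (R - ε) / 2 + ε / 2, rIn_pos := by linarith
      rIn_lt_rOut := by linarith }
  have hχ1 : ∀ s, ε ≤ s → s ≤ R → χ s = 1 := by
    intro s h1 h2
    apply χ.one_of_mem_closedBall
    rw [Metric.mem_closedBall, Real.dist_eq, abs_le]
    constructor <;> (show _ ≤ _; simp only [χ]; linarith)
  have hχ0 : ∀ s, (s ≤ ε / 2 ∨ R + ε / 2 ≤ s) → χ s = 0 := by
    intro s h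
    apply χ.zero_of_le_dist
    show (R - ε) / 2 + ε / 2 ≤ _
    rw [Real.dist_eq]
    rcases h with h | h
    · rw [le_abs]; right; linarith
    · rw [le_abs]; left; linarith
  let φ : ℝ → ℝ := fun s => c * (χ s * s ^ (-(α + 2) / 2))
  have hφ : ContDiff ℝ 1 φ := by
    rw [contDiff_iff_contDiffAt]
    intro s
    by_cases hs : s < ε / 2
    · have : φ =ᶠ[𝓝 s] fun _ => 0 := by
        filter_upwards [Iio_mem_nhds hs] with u hu
        simp [φ, hχ0 u (Or.inl (le_of_lt hu))]
      exact contDiffAt_const.congr_of_eventuallyEq this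
    · have hs0 : s ≠ 0 := by intro h; rw [h] at hs; apply hs; positivity
      exact contDiffAt_const.mul (χ.contDiff.contDiffAt.mul (Real.contDiffAt_rpow_const_of_ne hs0))
  let k : E2 → E2 := fun z => φ (‖z‖ ^ 2) • pvP z
  have hsm : ContDiff ℝ 1 k := (hφ.comp (contDiff_norm_sq ℝ)).smul pvP.contDiff
  refine ⟨k, hsm, ?_, ?_, ?_, ?_, ?_, ?_⟩
  · refine HasCompactSupport.intro (isCompact_closedBall (0:E2) (R + ε / 2 + 1)) fun z hz => ?_
    rw [mem_closedBall_zero_iff, not_le] at hz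
    have : R + ε / 2 ≤ ‖z‖ ^ 2 := by nlinarith [norm_nonneg z]
    simp [k, φ, hχ0 _ (Or.inr this)]
  · intro z; simp [k]
  · intro z; simp only [k, inner_smul_right, pvP_apply, pv_inner_perp, mul_zero]
  · intro z
    by_cases hz : z = 0
    · simp [k, hz]; positivity
    · have hz' : 0 < ‖z‖ := norm_pos_iff.2 hz
      have e1 : (‖z‖ ^ 2) ^ (-(α + 2) / 2) = ‖z‖ ^ (-(α + 2)) := by
        rw [← Real.rpow_natCast, ← Real.rpow_mul hz'.le]; congr 1; push_cast; ring
      have e2 : ‖z‖ ^ (-(1 + α)) = ‖z‖ ^ (-(α + 2)) * ‖z‖ := by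
        rw [show -(1 + α) = -(α + 2) + 1 by ring, Real.rpow_add_one hz'.ne']
      simp only [k, φ, norm_smul, pvP_apply, pv_norm_perp, e1, e2, norm_mul]
      have h1 : ‖χ (‖z‖ ^ 2)‖ ≤ 1 := by
        rw [Real.norm_of_nonneg χ.nonneg]; exact χ.le_one
      have h2 : ‖‖z‖ ^ (-(α + 2))‖ = ‖z‖ ^ (-(α + 2)) := Real.norm_of_nonneg (by positivity)
      rw [h2, Real.norm_eq_abs c, mul_assoc |c|]
      have h3 : 0 ≤ ‖z‖ ^ (-(α + 2)) := by positivity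
      gcongr
      nlinarith
  · intro z h1 h2
    have hz' : 0 < ‖z‖ := by
      rcases (norm_nonneg z).lt_or_eq with h | h
      · exact h
      · rw [← h] at h1; norm_num at h1; linarith
    have e1 : (‖z‖ ^ 2) ^ (-(α + 2) / 2) = ‖z‖ ^ (-(α + 2)) := by
      rw [← Real.rpow_natCast, ← Real.rpow_mul hz'.le]; congr 1; push_cast; ring
    simp only [k, φ, hχ1 _ h1 h2, pvP_apply, e1, Real.rpow_neg hz'.le, one_mul]
    rw [← div_eq_mul_inv]
  · intro z
    have h1 : HasFDerivAt (fun z : E2 => φ (‖z‖ ^ 2))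
        ((_root_.deriv φ (‖z‖ ^ 2)) • (2 • (innerSL ℝ z))) z := by
      have h2 : HasDerivAt φ (_root_.deriv φ (‖z‖ ^ 2)) (‖z‖ ^ 2) :=
        (hφ.differentiable (by norm_num) _).hasDerivAt
      exact HasDerivAt.comp_hasFDerivAt (f := fun z : E2 => ‖z‖ ^ 2) (h₂ := φ) z h2
        (hasStrictFDerivAt_norm_sq z).hasFDerivAt
    have h3 := h1.smul (pvP.hasFDerivAt (x := z))
    rw [show fderiv ℝ k z = _ from h3.fderiv]
    simp [Fin.sum_univ_two, pvP_apply, pv_perp_zero, pv_perp_one, pv_inner]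
    ring

lemma PVKer.flow {α c ε R : ℝ} {k : E2 → E2} (hk : PVKer α c ε R k) {N : ℕ} (a : Fin N → ℝ) :
    ∃ (Kc : ℝ≥0) (φ : ℝ → (Fin N → E2) → Fin N → E2), LipschitzWith Kc (pvV a k) ∧
      PVFlow (pvV a k) φ ∧
      (∀ t, 0 ≤ t → MeasurePreserving (φ t) volume volume) ∧
      Continuous (fun p : ℝ × (Fin N → E2) => φ (max p.1 0) p.2) := by
  obtain ⟨Ck, hCk⟩ := hk.smooth.lipschitzWith_of_hasCompactSupport hk.supp one_ne_zero
  obtain ⟨B, hB⟩ := hk.supp.exists_bound_of_continuous hk.smooth.continuous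
  have hB0 : 0 ≤ B := (norm_nonneg _).trans (hB 0)
  let Kc : ℝ≥0 := ⟨∑ j, |a j| * (Ck * 2), by positivity⟩
  let L : ℝ≥0 := ⟨∑ j, |a j| * B, by positivity⟩
  have hV : LipschitzWith Kc (pvV a k) := by
    refine LipschitzWith.of_dist_le_mul fun x y => ?_
    refine (dist_pi_le_iff (by positivity)).2 fun i => ?_
    rw [dist_eq_norm, dist_eq_norm]
    simp only [pvV]
    rw [← Finset.sum_sub_distrib]
    show _ ≤ (∑ j, |a j| * (Ck * 2)) * _
    rw [Finset.sum_mul]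
    refine (norm_sum_le _ _).trans (Finset.sum_le_sum fun j _ => ?_)
    rw [← smul_sub, norm_smul, Real.norm_eq_abs, mul_assoc, mul_assoc]
    gcongr
    refine (hCk.norm_sub_le _ _).trans ?_
    gcongr
    have h1 := norm_le_pi_norm (x - y) i
    have h2 := norm_le_pi_norm (x - y) j
    rw [show x i - x j - (y i - y j) = (x - y) i - (x - y) j by simp only [Pi.sub_apply]; abel]
    exact (norm_sub_le _ _).trans (by linarith)
  have hL : ∀ x, ‖pvV a k x‖ ≤ L := by
    intro x
    refine (pi_norm_le_iff_of_nonneg L.2).2 fun i => ?_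
    refine (norm_sum_le _ _).trans (Finset.sum_le_sum fun j _ => ?_)
    rw [norm_smul, Real.norm_eq_abs]
    gcongr
    exact hB _
  obtain ⟨φ, hφ⟩ := pv_exists_flow (pvV a k) Kc hV L hL
  refine ⟨Kc, φ, hV, hφ, ?_, hφ.continuous hV hL⟩
  let e : Fin N × Fin 2 → (Fin N → E2) := fun b => Pi.single b.1 (EuclideanSpace.single b.2 1)
  let v : Fin N × Fin 2 → (Fin N → E2) → ℝ := fun b x => pvV a k x b.1 b.2
  refine hφ.measurePreserving volume hV hL e v (fun _ => Kc) ?_ ?_ ?_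
  · intro b
    refine LipschitzWith.of_dist_le_mul fun x y => ?_
    refine le_trans ?_ (hV.dist_le_mul x y)
    rw [dist_eq_norm, dist_eq_norm]
    refine le_trans ?_ (norm_le_pi_norm _ b.1)
    exact PiLp.norm_apply_le (pvV a k x b.1 - pvV a k y b.1) b.2
  · intro x
    ext i m
    rw [Fintype.sum_prod_type]
    simp only [v, e, Finset.sum_apply, Pi.smul_apply, WithLp.ofLp_sum, WithLp.ofLp_smul]
    rw [Finset.sum_eq_single i, Finset.sum_eq_single m]
    · simp
    · intro b _ hb; simp [hb.symm]
    · simp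
    · intro b _ hb
      simp [Pi.single_eq_of_ne hb.symm]
    · simp
  · intro x
    have key : ∀ b : Fin N × Fin 2, lineDeriv ℝ (v b) x (e b) =
        ∑ j, a j * (if j = b.1 then 0 else
          (fderiv ℝ k (x b.1 - x j) (EuclideanSpace.single b.2 1)) b.2) := by
      rintro ⟨i, m⟩
      have h1 : HasLineDerivAt ℝ (v (i, m)) (∑ j, a j * (if j = i then 0 else
          (fderiv ℝ k (x i - x j) (EuclideanSpace.single m 1)) m)) x (e (i, m)) := by
        have h2 : ∀ j, HasDerivAt (fun t : ℝ => (k ((x + t • e (i, m)) i - (x + t • e (i, m)) j)) m)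
            (if j = i then 0 else (fderiv ℝ k (x i - x j) (EuclideanSpace.single m 1)) m) 0 := by
          intro j
          by_cases hj : j = i
          · subst hj
            simp only [sub_self, if_true]
            exact hasDerivAt_const _ _
          · simp only [hj, if_false]
            have h3 : ∀ t : ℝ, (x + t • e (i, m)) i - (x + t • e (i, m)) j
                = (x i - x j) + t • EuclideanSpace.single m (1:ℝ) := by
              intro t
              simp [e, Pi.single_eq_of_ne hj]; abel
            simp only [h3]
            have h4 : HasDerivAt (fun t : ℝ => (x i - x j) + t • EuclideanSpace.single m (1:ℝ))
                (EuclideanSpace.single m (1:ℝ)) 0 := by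
              simpa using ((hasDerivAt_id (0:ℝ)).smul_const (EuclideanSpace.single m (1:ℝ))).const_add (x i - x j)
            have h5 : HasFDerivAt k (fderiv ℝ k (x i - x j)) ((x i - x j) + (0:ℝ) • EuclideanSpace.single m (1:ℝ)) := by
              rw [zero_smul, add_zero]
              exact (hk.smooth.differentiable one_ne_zero _).hasFDerivAt
            have h6 := h5.comp_hasDerivAt (0:ℝ) h4
            exact ((EuclideanSpace.proj (𝕜 := ℝ) m).hasFDerivAt.comp_hasDerivAt (0:ℝ) h6)
        have h7 := HasDerivAt.fun_sum (u := Finset.univ) fun j _ => (h2 j).const_mul (a j)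
        refine HasDerivAt.congr_of_eventuallyEq h7 (Filter.Eventually.of_forall fun t => ?_)
        simp [v, pvV]
      exact h1.lineDeriv
    simp only [key]
    rw [Fintype.sum_prod_type]
    refine Finset.sum_eq_zero fun i _ => ?_
    rw [Finset.sum_comm]
    refine Finset.sum_eq_zero fun j _ => ?_
    rw [← Finset.mul_sum]
    by_cases hj : j = i
    · simp [hj]
    · simp only [hj, if_false]
      rw [hk.div, mul_zero]

end kernel

section psi
open Filter Topology
open scoped NNReal ENNReal

lemma pv_int_one (q ρ : ℝ) (hq : q < 2) :
    IntegrableOn (fun z : E2 => ‖z‖ ^ (-q)) (Metric.ball 0 ρ) volume := by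
  rw [integrableOn_fun_norm_addHaar (E := E2) volume (f := fun y : ℝ => y ^ (-q))]
  simp only [finrank_euclideanSpace, Fintype.card_fin, smul_eq_mul]
  have h1 : IntegrableOn (fun y : ℝ => y ^ (1 - q)) (Set.Ioo 0 ρ) volume := by
    rcases le_total 0 ρ with h | h
    · exact ((intervalIntegrable_iff_integrableOn_Ioc_of_le h).1
        (intervalIntegral.intervalIntegrable_rpow' (by linarith))).mono_set Set.Ioo_subset_Ioc_self
    · rw [Set.Ioo_eq_empty (not_lt.2 h)]; exact integrableOn_empty
  refine h1.congr_fun (fun y hy => ?_) measurableSet_Ioo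
  simp only [Nat.reduceSub, pow_one]
  rw [sub_eq_add_neg, Real.rpow_add hy.1, Real.rpow_one]

lemma pv_int_pair {N : ℕ} (α ρ : ℝ) (hα1 : α < 1) (i j l : Fin N) (hij : i ≠ j)
    (hil : i ≠ l) (hjl : j ≠ l) :
    IntegrableOn (fun x : Fin N → E2 => ‖x i - x j‖ ^ (-1:ℝ) * ‖x i - x l‖ ^ (-(1 + α)))
      (Metric.ball 0 ρ) volume := by
  let q : Fin N → ℝ := fun m => if m = j then 1 else if m = l then 1 + α else 0
  have hq : ∀ m, q m < 2 := by
    intro m; simp only [q]; split_ifs <;> linarith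
  let F : Fin N → E2 → ℝ := fun m => (Metric.ball 0 (2 * ρ)).indicator fun z => ‖z‖ ^ (-(q m))
  have hF : ∀ m, Integrable (F m) volume := fun m =>
    (integrable_indicator_iff measurableSet_ball).2 (pv_int_one _ _ (hq m))
  have hG : Integrable (fun y : Fin N → E2 => ∏ m, F m (y m)) volume :=
    Integrable.fintype_prod hF
  let L : (Fin N → E2) →ₗ[ℝ] (Fin N → E2) :=
    { toFun := fun x m => if m = j ∨ m = l then x i - x m else x m
      map_add' := fun x y => by
        funext m; simp only [Pi.add_apply]; split_ifs
        · abel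
        · rfl
      map_smul' := fun r x => by
        funext m; simp only [Pi.smul_apply, RingHom.id_apply]; split_ifs
        · rw [smul_sub]
        · rfl }
  have hLa : ∀ x m, L x m = if m = j ∨ m = l then x i - x m else x m := fun x m => rfl
  have hLL : L ∘ₗ L = LinearMap.id := by
    apply LinearMap.ext
    intro x
    funext m
    simp only [LinearMap.comp_apply, LinearMap.id_apply, hLa, hij, hil, or_self, if_false]
    split_ifs
    · abel
    · rfl
  have hdet : LinearMap.det L ≠ 0 := by
    intro h
    have := congrArg LinearMap.det hLL
    rw [LinearMap.det_comp, h, LinearMap.det_id] at this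
    norm_num at this
  have hmap := Measure.map_linearMap_addHaar_eq_smul_addHaar (volume : Measure (Fin N → E2)) hdet
  have hG2 : Integrable (fun y : Fin N → E2 => ∏ m, F m (y m)) (Measure.map L volume) := by
    rw [hmap]
    exact hG.smul_measure ENNReal.ofReal_ne_top
  have hLc : Continuous L := L.continuous_of_finiteDimensional
  have hG3 := hG2.comp_measurable hLc.measurable
  refine (hG3.integrableOn (s := Metric.ball 0 ρ)).congr_fun (fun x hx => ?_) measurableSet_ball
  rw [mem_ball_zero_iff] at hx
  have hρ : 0 < ρ := (norm_nonneg _).trans_lt hx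
  have hxm : ∀ m, ‖x m‖ < ρ := fun m => (norm_le_pi_norm x m).trans_lt hx
  have hmem : ∀ m, L x m ∈ Metric.ball (0:E2) (2 * ρ) := by
    intro m
    rw [mem_ball_zero_iff, hLa]
    split_ifs
    · exact (norm_sub_le _ _).trans_lt (by linarith [hxm i, hxm m])
    · linarith [hxm m]
  simp only [Function.comp, F]
  rw [Finset.prod_congr rfl (fun m _ => Set.indicator_of_mem (hmem m) _)]
  rw [← Finset.mul_prod_erase _ _ (Finset.mem_univ j),
    ← Finset.mul_prod_erase _ _ (Finset.mem_erase.2 ⟨hjl.symm, Finset.mem_univ l⟩),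
    Finset.prod_eq_one, mul_one]
  · simp [hLa, q, hjl.symm]
  · intro m hm
    simp only [Finset.mem_erase, Finset.mem_univ, and_true] at hm
    simp [q, hm.1, hm.2]

def pvPsi (α : ℝ) {N : ℕ} (a : Fin N → ℝ) (x : Fin N → E2) : ℝ :=
  ∑ i, ∑ j, ∑ l, if i ≠ j ∧ i ≠ l ∧ j ≠ l then
    |a l| * (‖x i - x j‖ ^ (-1:ℝ) * (‖x i - x l‖ ^ (-(1 + α)) + ‖x j - x l‖ ^ (-(1 + α)))) else 0

lemma pvPsi_measurable (α : ℝ) {N : ℕ} (a : Fin N → ℝ) : Measurable (pvPsi α a) := by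
  unfold pvPsi
  refine Finset.measurable_sum _ fun i _ => Finset.measurable_sum _ fun j _ =>
    Finset.measurable_sum _ fun l _ => ?_
  split_ifs
  · fun_prop
  · exact measurable_const

lemma pvPsi_int (α : ℝ) (hα1 : α < 1) {N : ℕ} (a : Fin N → ℝ) (ρ : ℝ) :
    IntegrableOn (pvPsi α a) (Metric.ball 0 ρ) volume := by
  unfold pvPsi
  refine integrable_finsetSum _ fun i _ => integrable_finsetSum _ fun j _ =>
    integrable_finsetSum _ fun l _ => ?_
  split_ifs with h
  · refine Integrable.const_mul ?_ _
    simp only [mul_add]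
    refine Integrable.add (pv_int_pair α ρ hα1 i j l h.1 h.2.1 h.2.2) ?_
    have := pv_int_pair α ρ hα1 j i l h.1.symm h.2.2 h.2.1
    have e : ∀ x : Fin N → E2, ‖x j - x i‖ = ‖x i - x j‖ := fun x => norm_sub_rev _ _
    simp only [e] at this
    exact this
  · exact integrable_zero _ _ _

lemma pvPsi_nonneg (α : ℝ) {N : ℕ} (a : Fin N → ℝ) (x : Fin N → E2) : 0 ≤ pvPsi α a x := by
  unfold pvPsi
  refine Finset.sum_nonneg fun i _ => Finset.sum_nonneg fun j _ => Finset.sum_nonneg fun l _ => ?_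
  split_ifs <;> positivity

lemma pv_le_psi (α : ℝ) {N : ℕ} (a : Fin N → ℝ) (x : Fin N → E2) (i j : Fin N) (hij : i ≠ j) :
    ‖x i - x j‖ ^ (-1:ℝ) * ∑ l, (if l ≠ i ∧ l ≠ j then
      |a l| * (‖x i - x l‖ ^ (-(1 + α)) + ‖x j - x l‖ ^ (-(1 + α))) else 0) ≤ pvPsi α a x := by
  unfold pvPsi
  have h0 : ∀ i j l : Fin N, 0 ≤ if i ≠ j ∧ i ≠ l ∧ j ≠ l then
    |a l| * (‖x i - x j‖ ^ (-1:ℝ) * (‖x i - x l‖ ^ (-(1 + α)) + ‖x j - x l‖ ^ (-(1 + α)))) else 0 := by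
    intro i j l
    split_ifs <;> positivity
  refine le_trans ?_ (Finset.single_le_sum (f := fun i => ∑ j, ∑ l, if i ≠ j ∧ i ≠ l ∧ j ≠ l then
    |a l| * (‖x i - x j‖ ^ (-1:ℝ) * (‖x i - x l‖ ^ (-(1 + α)) + ‖x j - x l‖ ^ (-(1 + α)))) else 0)
    (fun i _ => Finset.sum_nonneg fun j _ => Finset.sum_nonneg fun l _ => h0 i j l)
    (Finset.mem_univ i))
  refine le_trans ?_ (Finset.single_le_sum (f := fun j => ∑ l, if i ≠ j ∧ i ≠ l ∧ j ≠ l then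
    |a l| * (‖x i - x j‖ ^ (-1:ℝ) * (‖x i - x l‖ ^ (-(1 + α)) + ‖x j - x l‖ ^ (-(1 + α)))) else 0)
    (fun j _ => Finset.sum_nonneg fun l _ => h0 i j l)
    (Finset.mem_univ j))
  rw [Finset.mul_sum]
  refine Finset.sum_le_sum fun l _ => ?_
  by_cases h : l ≠ i ∧ l ≠ j
  · rw [if_pos h, if_pos ⟨hij, h.1.symm, h.2.symm⟩]
    apply le_of_eq; ring
  · rw [if_neg h, mul_zero]; exact h0 i j l

lemma pv_inner_bound {α c ε R : ℝ} {k : E2 → E2} (hk : PVKer α c ε R k) {N : ℕ}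
    (a : Fin N → ℝ) (x : Fin N → E2) (i j : Fin N) (hij : i ≠ j) :
    |inner ℝ (x i - x j) (pvV a k x i - pvV a k x j)| ≤ ‖x i - x j‖ *
      (|c| * ∑ l, (if l ≠ i ∧ l ≠ j then
      |a l| * (‖x i - x l‖ ^ (-(1 + α)) + ‖x j - x l‖ ^ (-(1 + α))) else 0)) := by
  have hk0 : k 0 = 0 := by
    have h := hk.odd 0
    rw [neg_zero] at h
    have h2 : (2:ℝ) • k 0 = 0 := by rw [two_smul]; nth_rewrite 1 [h]; simp
    exact (smul_eq_zero.1 h2).resolve_left (by norm_num)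
  have e1 : inner ℝ (x i - x j) (pvV a k x i - pvV a k x j) =
      ∑ l, a l * inner ℝ (x i - x j) (k (x i - x l) - k (x j - x l)) := by
    simp only [pvV]
    rw [← Finset.sum_sub_distrib, inner_sum]
    refine Finset.sum_congr rfl fun l _ => ?_
    rw [← smul_sub, inner_smul_right]
  rw [e1, Finset.mul_sum, Finset.mul_sum]
  refine (Finset.abs_sum_le_sum_abs _ _).trans (Finset.sum_le_sum fun l _ => ?_)
  by_cases h : l ≠ i ∧ l ≠ j
  · rw [if_pos h, abs_mul]
    have h1 := abs_real_inner_le_norm (x i - x j) (k (x i - x l) - k (x j - x l))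
    have h2 := norm_sub_le (k (x i - x l)) (k (x j - x l))
    have h3 := hk.bound (x i - x l)
    have h4 := hk.bound (x j - x l)
    calc _ ≤ |a l| * (‖x i - x j‖ * (|c| * ‖x i - x l‖ ^ (-(1 + α)) + |c| * ‖x j - x l‖ ^ (-(1 + α)))) := by
          gcongr
          refine h1.trans ?_
          gcongr
          linarith
      _ = _ := by ring
  · rw [if_neg h]
    have : inner ℝ (x i - x j) (k (x i - x l) - k (x j - x l)) = 0 := by
      by_cases h1 : l = i
      · subst h1
        rw [sub_self, hk0, zero_sub, ← hk.odd, neg_sub, hk.orth]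
      · have h2 : l = j := by
          by_contra h2; exact h ⟨h1, h2⟩
        subst h2
        rw [sub_self, hk0, sub_zero, hk.orth]
    rw [this]; simp

lemma pv_log_estimate {α c ε R : ℝ} (hε : 0 < ε) {k : E2 → E2} (hk : PVKer α c ε R k) {N : ℕ}
    (a : Fin N → ℝ) (x : ℝ → Fin N → E2) (hx : ∀ t, HasDerivAt x (pvV a k (x t)) t)
    (i j : Fin N) (hij : i ≠ j) (T t : ℝ) (ht : t ∈ Set.Icc 0 T) :
    ENNReal.ofReal (Real.log (‖x 0 i - x 0 j‖ ^ 2 + ε) - Real.log (‖x t i - x t j‖ ^ 2 + ε)) ≤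
      ∫⁻ s in Set.Icc 0 T, ENNReal.ofReal (2 * |c| * pvPsi α a (x s)) := by
  have hxi : ∀ i t, HasDerivAt (fun t => x t i) (pvV a k (x t) i) t := fun i t =>
    hasDerivAt_pi.1 (hx t) i
  have hxc : Continuous x := continuous_iff_continuousAt.2 fun t => (hx t).continuousAt
  let g' : ℝ → ℝ := fun s => 2 * inner ℝ (x s i - x s j) (pvV a k (x s) i - pvV a k (x s) j) /
    (‖x s i - x s j‖ ^ 2 + ε)
  have hpos : ∀ s, 0 < ‖x s i - x s j‖ ^ 2 + ε := fun s => by positivity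
  have hg : ∀ s, HasDerivAt (fun s => Real.log (‖x s i - x s j‖ ^ 2 + ε)) (g' s) s := by
    intro s
    exact ((((hxi i s).sub (hxi j s)).norm_sq).add_const ε).log (hpos s).ne'
  have hg'c : Continuous g' := by
    have hkc := hk.smooth.continuous
    have hVc : ∀ i, Continuous fun s => pvV a k (x s) i := by
      intro i; unfold pvV; fun_prop
    have h1 := hVc i
    have h2 := hVc j
    exact ((continuous_const.mul (Continuous.inner (by fun_prop) (h1.sub h2)))).div (by fun_prop)
      fun s => (hpos s).ne'
  have hb : ∀ s, |g' s| ≤ 2 * |c| * pvPsi α a (x s) := by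
    intro s
    have h1 := pv_inner_bound hk a (x s) i j hij
    have h2 := pv_le_psi α a (x s) i j hij
    set S := ∑ l, (if l ≠ i ∧ l ≠ j then
      |a l| * (‖x s i - x s l‖ ^ (-(1 + α)) + ‖x s j - x s l‖ ^ (-(1 + α))) else 0) with hS
    have hS0 : 0 ≤ S := Finset.sum_nonneg fun l _ => by split_ifs <;> positivity
    clear_value S
    clear hS
    have h3 : ‖x s i - x s j‖ / (‖x s i - x s j‖ ^ 2 + ε) ≤ ‖x s i - x s j‖ ^ (-1:ℝ) := by
      rw [Real.rpow_neg_one]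
      rcases (norm_nonneg (x s i - x s j)).lt_or_eq with h | h
      · rw [div_le_iff₀ (hpos s), inv_mul_eq_div, le_div_iff₀ h]; nlinarith
      · rw [← h]; simp
    rw [abs_div, abs_mul, abs_of_pos (hpos s), abs_two]
    calc _ ≤ 2 * (‖x s i - x s j‖ * (|c| * S)) / (‖x s i - x s j‖ ^ 2 + ε) :=
          div_le_div_of_nonneg_right (mul_le_mul_of_nonneg_left h1 zero_le_two) (hpos s).le
      _ = 2 * |c| * (‖x s i - x s j‖ / (‖x s i - x s j‖ ^ 2 + ε) * S) := by ring
      _ ≤ 2 * |c| * (‖x s i - x s j‖ ^ (-1:ℝ) * S) :=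
          mul_le_mul_of_nonneg_left (mul_le_mul_of_nonneg_right h3 hS0) (by positivity)
      _ ≤ _ := mul_le_mul_of_nonneg_left h2 (by positivity)
  have hftc := intervalIntegral.integral_eq_sub_of_hasDerivAt (a := 0) (b := t)
    (fun s _ => hg s) (hg'c.intervalIntegrable _ _)
  have hle : Real.log (‖x 0 i - x 0 j‖ ^ 2 + ε) - Real.log (‖x t i - x t j‖ ^ 2 + ε) ≤
      ‖∫ s in (0:ℝ)..t, g' s‖ := by
    rw [hftc, Real.norm_eq_abs, abs_sub_comm]; exact le_abs_self _
  refine (ENNReal.ofReal_le_ofReal hle).trans ?_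
  rw [ofReal_norm_eq_enorm, intervalIntegral.integral_of_le ht.1]
  refine (enorm_integral_le_lintegral_enorm _).trans ?_
  refine (lintegral_mono_set (t := Set.Icc 0 T) fun s hs => ⟨hs.1.le, hs.2.trans ht.2⟩).trans ?_
  refine lintegral_mono fun s => ?_
  rw [← ofReal_norm_eq_enorm]
  exact ENNReal.ofReal_le_ofReal (hb s)

end psi

section sols
open Filter Topology
open scoped NNReal ENNReal

lemma PVKer.zero {α c ε R : ℝ} {k : E2 → E2} (hk : PVKer α c ε R k) : k 0 = 0 := by
  have h := hk.odd 0
  rw [neg_zero] at h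
  have h2 : (2:ℝ) • k 0 = 0 := by rw [two_smul]; nth_rewrite 1 [h]; simp
  exact (smul_eq_zero.1 h2).resolve_left (by norm_num)

lemma pv_exists_c (α : ℝ) : ∃ c : ℝ, ∀ z, K' α z = (c / ‖z‖ ^ (α + 2)) • perp z := by
  by_cases h : α = 0
  · refine ⟨-(1 / (2 * Real.pi)), fun z => ?_⟩
    simp only [K', h, if_true, zero_add]
  · refine ⟨-(α * Cconst α), fun z => ?_⟩
    simp only [K', h, if_false, K]

lemma pv_int_sum {α c ε R : ℝ} {k : E2 → E2} (hk : PVKer α c ε R k) {N : ℕ}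
    (a : Fin N → ℝ) (w : ℝ → Fin N → E2) (hw : Continuous w) (i : Fin N) (t : ℝ) :
    ∫ s in (0:ℝ)..t, pvV a k (w s) i =
      ∑ j ∈ Finset.univ.erase i, a j • ∫ s in (0:ℝ)..t, k (w s i - w s j) := by
  have hkc := hk.smooth.continuous
  simp only [pvV]
  rw [intervalIntegral.integral_finsetSum]
  · rw [← Finset.add_sum_erase _ _ (Finset.mem_univ i)]
    simp only [sub_self, hk.zero, smul_zero, intervalIntegral.integral_zero, zero_add]
    refine Finset.sum_congr rfl fun j _ => ?_
    rw [intervalIntegral.integral_smul]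
  · intro j _
    apply Continuous.intervalIntegrable
    fun_prop

lemma pv_is_sol {α c ε R : ℝ} {k : E2 → E2} (hε : 0 < ε) (hk : PVKer α c ε R k)
    (hc : ∀ z, K' α z = (c / ‖z‖ ^ (α + 2)) • perp z) {N : ℕ}
    (a : Fin N → ℝ) (x : ℝ → Fin N → E2) (hx : ∀ t, HasDerivAt x (pvV a k (x t)) t) (T : ℝ)
    (hsep : ∀ t ∈ Set.Icc 0 T, ∀ i j, i ≠ j → ε ≤ ‖x t i - x t j‖ ^ 2 ∧ ‖x t i - x t j‖ ^ 2 ≤ R) :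
    IsPVSol' α a (x 0) T x := by
  have hxc : Continuous x := continuous_iff_continuousAt.2 fun t => (hx t).continuousAt
  have hkc := hk.smooth.continuous
  refine ⟨hxc.continuousOn, ?_, ?_⟩
  · intro t ht i j hij h
    have := (hsep t ht i j hij).1
    rw [h, sub_self, norm_zero] at this
    norm_num at this; linarith
  · intro i t ht
    have hftc := intervalIntegral.integral_eq_sub_of_hasDerivAt (a := 0) (b := t)
      (f := fun t => x t i) (f' := fun t => pvV a k (x t) i)
      (fun s _ => hasDerivAt_pi.1 (hx s) i) (by
        apply Continuous.intervalIntegrable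
        unfold pvV; fun_prop)
    rw [pv_int_sum hk a x hxc] at hftc
    rw [eq_sub_iff_add_eq'] at hftc
    rw [← hftc]
    congr 1
    refine Finset.sum_congr rfl fun j hj => ?_
    congr 1
    refine intervalIntegral.integral_congr fun s hs => ?_
    rw [Set.uIcc_of_le ht.1] at hs
    have h1 := hsep s ⟨hs.1, hs.2.trans ht.2⟩ i j (Finset.ne_of_mem_erase hj).symm
    rw [hc, hk.eq _ h1.1 h1.2]

lemma pv_sol_bounds {α : ℝ} {N : ℕ} {a : Fin N → ℝ} {x0 : Fin N → E2} {T : ℝ}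
    {x : ℝ → Fin N → E2} (h : IsPVSol' α a x0 T x) :
    (∀ᶠ ε in 𝓝[>] (0:ℝ), ∀ i j, i ≠ j → ∀ t ∈ Set.Icc 0 T, ε ≤ ‖x t i - x t j‖ ^ 2) ∧
    (∀ᶠ R in atTop, ∀ i j, i ≠ j → ∀ t ∈ Set.Icc 0 T, ‖x t i - x t j‖ ^ 2 ≤ R) := by
  have hcont : ∀ i j, ContinuousOn (fun t => ‖x t i - x t j‖ ^ 2) (Set.Icc 0 T) := by
    intro i j
    have h1 : ∀ i, ContinuousOn (fun t => x t i) (Set.Icc 0 T) := fun i =>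
      (continuousOn_pi.1 h.1) i
    exact ((h1 i).sub (h1 j)).norm.pow 2
  constructor
  · rw [eventually_all]; intro i
    rw [eventually_all]; intro j
    rw [eventually_imp_distrib_left]; intro hij
    rcases (Set.Icc 0 T).eq_empty_or_nonempty with he | hne
    · rw [he]; simp
    obtain ⟨t0, ht0, hmin⟩ := isCompact_Icc.exists_isMinOn hne (hcont i j)
    have hp : 0 < ‖x t0 i - x t0 j‖ ^ 2 := by
      have := norm_pos_iff.2 (sub_ne_zero.2 (h.2.1 t0 ht0 i j hij))
      positivity
    filter_upwards [Ioc_mem_nhdsGT hp] with ε hε t ht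
    exact hε.2.trans (hmin ht)
  · rw [eventually_all]; intro i
    rw [eventually_all]; intro j
    rw [eventually_imp_distrib_left]; intro hij
    obtain ⟨B, hB⟩ := isCompact_Icc.bddAbove_image (hcont i j)
    filter_upwards [eventually_ge_atTop B] with R hR t ht
    exact (hB ⟨t, ht, rfl⟩).trans hR

lemma pv_sol_deriv {α c ε R : ℝ} {k : E2 → E2} (hk : PVKer α c ε R k)
    (hc : ∀ z, K' α z = (c / ‖z‖ ^ (α + 2)) • perp z) {N : ℕ}
    {a : Fin N → ℝ} {x0 : Fin N → E2} {T : ℝ} (hT : 0 ≤ T)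
    {x : ℝ → Fin N → E2} (h : IsPVSol' α a x0 T x)
    (h1 : ∀ i j, i ≠ j → ∀ t ∈ Set.Icc 0 T, ε ≤ ‖x t i - x t j‖ ^ 2)
    (h2 : ∀ i j, i ≠ j → ∀ t ∈ Set.Icc 0 T, ‖x t i - x t j‖ ^ 2 ≤ R) :
    x 0 = x0 ∧ ∀ t ∈ Set.Ico 0 T, HasDerivWithinAt x (pvV a k (x t)) (Set.Ici t) t := by
  have hkc := hk.smooth.continuous
  constructor
  · funext i
    rw [h.2.2 i 0 ⟨le_rfl, hT⟩]; simp
  intro t ht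
  let w : ℝ → Fin N → E2 := Set.IccExtend hT ((Set.Icc 0 T).restrict x)
  have hw : Continuous w := (continuousOn_iff_continuous_restrict.1 h.1).Icc_extend'
  have hwx : ∀ s ∈ Set.Icc 0 T, w s = x s := fun s hs => Set.IccExtend_of_mem hT _ hs
  rw [hasDerivWithinAt_pi]
  intro i
  have hVc : Continuous fun s => pvV a k (w s) i := by unfold pvV; fun_prop
  have hF : HasDerivAt (fun t => x0 i + ∫ s in (0:ℝ)..t, pvV a k (w s) i) (pvV a k (w t) i) t :=
    (hVc.integral_hasStrictDerivAt 0 t).hasDerivAt.const_add _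
  have hxF : ∀ t ∈ Set.Icc 0 T, x t i = x0 i + ∫ s in (0:ℝ)..t, pvV a k (w s) i := by
    intro t ht
    rw [h.2.2 i t ht, pv_int_sum hk a w hw]
    congr 1
    refine Finset.sum_congr rfl fun j hj => ?_
    congr 1
    refine intervalIntegral.integral_congr fun s hs => ?_
    rw [Set.uIcc_of_le ht.1] at hs
    have hs' : s ∈ Set.Icc 0 T := ⟨hs.1, hs.2.trans ht.2⟩
    have hij := (Finset.ne_of_mem_erase hj).symm
    rw [hc, hwx s hs', hk.eq _ (h1 i j hij s hs') (h2 i j hij s hs')]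
  have ht' : t ∈ Set.Icc 0 T := ⟨ht.1, ht.2.le⟩
  rw [← hwx t ht']
  refine hF.hasDerivWithinAt.congr_of_eventuallyEq ?_ (hxF t ht')
  filter_upwards [Ico_mem_nhdsGE ht.2] with s hs
  exact hxF s ⟨ht.1.trans hs.1, hs.2.le⟩

lemma pv_unique {α : ℝ} (hα : 0 ≤ α) {N : ℕ}
    {a : Fin N → ℝ} {x0 : Fin N → E2} {T : ℝ} (hT : 0 ≤ T)
    {x y : ℝ → Fin N → E2} (hx : IsPVSol' α a x0 T x) (hy : IsPVSol' α a x0 T y) :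
    ∀ t ∈ Set.Icc (0:ℝ) T, x t = y t := by
  obtain ⟨c, hc⟩ := pv_exists_c α
  have bx := pv_sol_bounds hx
  have by' := pv_sol_bounds hy
  obtain ⟨ε, ⟨hε1, hε2⟩, hε⟩ := ((bx.1.and by'.1).and self_mem_nhdsWithin).exists
  obtain ⟨R, ⟨hR1, hR2⟩, hR⟩ := ((bx.2.and by'.2).and (eventually_gt_atTop ε)).exists
  obtain ⟨k, hk⟩ := pv_exists_ker α c ε R hα hε hR
  obtain ⟨Kc, -, hV, -⟩ := hk.flow a
  obtain ⟨x00, hx'⟩ := pv_sol_deriv hk hc hT hx hε1 hR1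
  obtain ⟨y00, hy'⟩ := pv_sol_deriv hk hc hT hy hε2 hR2
  exact ODE_solution_unique (v := fun _ => pvV a k) (K := Kc) (fun _ => hV) hx.1 hx' hy.1 hy'
    (x00.trans y00.symm)

lemma pv_bad_null {α : ℝ} (hα0 : 0 ≤ α) (hα1 : α < 1) {N : ℕ} (a : Fin N → ℝ)
    (hgen : ∀ P : Finset (Fin N), P.Nonempty → ∑ i ∈ P, a i ≠ 0) (R0 δ T : ℝ)
    (hδ : 0 < δ) (hT : 0 ≤ T) :
    volume {x : Fin N → E2 | ‖x‖ ≤ R0 ∧ (∀ i j, i ≠ j → δ ≤ ‖x i - x j‖ ^ 2) ∧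
      ¬ ∃ y, IsPVSol' α a x T y} = 0 := by
  obtain ⟨c, hc⟩ := pv_exists_c α
  obtain ⟨C, hC0, hC⟩ := pv_bounded a hgen |c| T (abs_nonneg c) hT
  set S := {x : Fin N → E2 | ‖x‖ ≤ R0 ∧ (∀ i j, i ≠ j → δ ≤ ‖x i - x j‖ ^ 2) ∧
      ¬ ∃ y, IsPVSol' α a x T y} with hS
  let ρ := |R0| + C + 1
  have hρ : 0 < ρ := by positivity
  let h : (Fin N → E2) → ℝ≥0∞ := (Metric.ball 0 ρ).indicator
    fun x => ENNReal.ofReal (2 * |c| * pvPsi α a x)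
  have hm : Measurable h := by
    refine Measurable.indicator ?_ measurableSet_ball
    exact ((pvPsi_measurable α a).const_mul _).ennreal_ofReal
  let I := ∫⁻ x, h x
  have hI : I < ⊤ := by
    simp only [I, h]
    rw [lintegral_indicator measurableSet_ball]
    exact ((pvPsi_int α hα1 a ρ).const_mul (2 * |c|)).lintegral_lt_top
  have main : ∀ n : ℕ, volume S ≤ (I * ENNReal.ofReal T) / ((n + 1 : ℕ) : ℝ≥0∞) := by
    intro n
    let ε := δ / 2 * Real.exp (-((n:ℝ) + 1))
    have hε : 0 < ε := by positivity
    have hεδ : ε < δ := by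
      have : Real.exp (-((n:ℝ) + 1)) ≤ 1 := Real.exp_le_one_iff.2 (by linarith [n.cast_nonneg (α := ℝ)])
      simp only [ε]; nlinarith
    let R := (2 * ρ) ^ 2 + δ
    have hR : ε < R := by simp only [R]; nlinarith
    obtain ⟨k, hk⟩ := pv_exists_ker α c ε R hα0 hε hR
    obtain ⟨Kc, φ, hV, hφ, hmp, hφc⟩ := hk.flow a
    have hkM : ∀ z, 1 ≤ ‖z‖ → ‖k z‖ ≤ |c| := by
      intro z hz
      refine (hk.bound z).trans ?_
      have : ‖z‖ ^ (-(1 + α)) ≤ 1 := Real.rpow_le_one_of_one_le_of_nonpos hz (by linarith)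
      nlinarith [abs_nonneg c]
    let H : (Fin N → E2) → ℝ≥0∞ := fun x => ∫⁻ s in Set.Icc 0 T, h (φ (max s 0) x)
    have hHm : Measurable (Function.uncurry fun (x : Fin N → E2) (s : ℝ) => h (φ (max s 0) x)) :=
      hm.comp (hφc.measurable.comp measurable_swap)
    have hHmeas : Measurable H := hHm.lintegral_prod_right'
    have hHint : ∫⁻ x, H x = I * ENNReal.ofReal T := by
      simp only [H]
      rw [lintegral_lintegral_swap hHm.aemeasurable]
      have : ∀ s : ℝ, ∫⁻ x, h (φ (max s 0) x) = I := fun s =>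
        (hmp _ (le_max_right _ _)).lintegral_comp hm
      simp only [this, lintegral_const]
      simp
    have hsub : S ⊆ {x | ((n + 1 : ℕ) : ℝ≥0∞) ≤ H x} := by
      rintro x ⟨hx0, hxsep, hxno⟩
      have hxd : ∀ t, HasDerivAt (fun t => φ t x) (pvV a k (φ t x)) t := hφ.deriv x
      have hball : ∀ t ∈ Set.Icc 0 T, φ t x ∈ Metric.ball (0 : Fin N → E2) ρ := by
        intro t ht
        have h1 := hC k hk.odd hkM (fun t => φ t x) hxd t ht
        rw [mem_ball_zero_iff]
        refine lt_of_le_of_lt (b := |R0| + C) ?_ (by simp only [ρ]; linarith)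
        refine (pi_norm_le_iff_of_nonneg (by positivity)).2 fun i => ?_
        have h2 := h1 i
        rw [hφ.zero] at h2
        have h3 := norm_le_pi_norm x i
        have h4 := norm_le_norm_add_norm_sub' (φ t x i) (x i)
        linarith [le_abs_self R0]
      have hbad : ∃ t ∈ Set.Icc 0 T, ∃ i j, i ≠ j ∧ ‖φ t x i - φ t x j‖ ^ 2 < ε := by
        by_contra hcon
        push Not at hcon
        apply hxno
        have := pv_is_sol hε hk hc a (fun t => φ t x) hxd T (fun t ht i j hij =>
          ⟨hcon t ht i j hij, ?_⟩)
        · rw [hφ.zero] at this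
          exact ⟨_, this⟩
        · have h1 := mem_ball_zero_iff.1 (hball t ht)
          have h2 := norm_le_pi_norm (φ t x) i
          have h3 := norm_le_pi_norm (φ t x) j
          have h4 := norm_sub_le (φ t x i) (φ t x j)
          have h5 : ‖φ t x i - φ t x j‖ ≤ 2 * ρ := by linarith
          have h6 : ‖φ t x i - φ t x j‖ ^ 2 ≤ (2 * ρ) ^ 2 := by gcongr
          simp only [R]; linarith
      obtain ⟨t, ht, i, j, hij, hlt⟩ := hbad
      have hest := pv_log_estimate hε hk a (fun t => φ t x) hxd i j hij T t ht
      simp only [hφ.zero] at hest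
      have hH : H x = ∫⁻ s in Set.Icc 0 T, ENNReal.ofReal (2 * |c| * pvPsi α a (φ s x)) := by
        refine setLIntegral_congr_fun measurableSet_Icc fun s hs => ?_
        simp only [max_eq_left hs.1, h]
        rw [Set.indicator_of_mem (hball s hs)]
      show _ ≤ H x
      rw [hH]
      refine le_trans ?_ hest
      rw [← ENNReal.ofReal_natCast]
      apply ENNReal.ofReal_le_ofReal
      have l1 : Real.log δ ≤ Real.log (‖x i - x j‖ ^ 2 + ε) :=
        Real.log_le_log hδ (by linarith [hxsep i j hij])
      have l2 : Real.log (‖φ t x i - φ t x j‖ ^ 2 + ε) ≤ Real.log (2 * ε) :=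
        Real.log_le_log (by positivity) (by linarith)
      have l3 : Real.log (2 * ε) = Real.log δ - (n + 1) := by
        rw [show 2 * ε = δ * Real.exp (-((n:ℝ) + 1)) by simp only [ε]; ring,
          Real.log_mul hδ.ne' (Real.exp_pos _).ne', Real.log_exp]
        ring
      push_cast
      linarith
    refine (measure_mono hsub).trans ?_
    rw [← hHint]
    exact meas_ge_le_lintegral_div hHmeas.aemeasurable (by simp) (ENNReal.natCast_ne_top _)
  have hlim : Tendsto (fun n : ℕ => (I * ENNReal.ofReal T) / ((n + 1 : ℕ) : ℝ≥0∞)) atTop (𝓝 0) := by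
    have h1 : Tendsto (fun n : ℕ => ((n + 1 : ℕ) : ℝ≥0∞)) atTop (𝓝 ⊤) :=
      ENNReal.tendsto_nat_nhds_top.comp (tendsto_add_atTop_nat 1)
    have h2 := ENNReal.Tendsto.const_div (a := I * ENNReal.ofReal T) h1
      (Or.inr (ENNReal.mul_ne_top hI.ne ENNReal.ofReal_ne_top))
    simpa using h2
  exact le_antisymm (ge_of_tendsto' hlim main) zero_le

lemma pv_diag_null (N : ℕ) :
    volume {y : Fin N → E2 | ∃ i j : Fin N, i ≠ j ∧ y i = y j} = 0 := by
  have : {y : Fin N → E2 | ∃ i j : Fin N, i ≠ j ∧ y i = y j} ⊆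
      ⋃ i : Fin N, ⋃ j : Fin N, {y | i ≠ j ∧ y i = y j} := by
    rintro y ⟨i, j, h⟩
    simp only [Set.mem_iUnion]
    exact ⟨i, j, h⟩
  refine measure_mono_null this ?_
  rw [measure_iUnion_null_iff]; intro i
  rw [measure_iUnion_null_iff]; intro j
  by_cases hij : i = j
  · simp [hij]
  let s : Submodule ℝ (Fin N → E2) :=
    LinearMap.ker ((LinearMap.proj i : (Fin N → E2) →ₗ[ℝ] E2) - LinearMap.proj j)
  have hs : s ≠ ⊤ := by
    intro h
    have h1 : (Pi.single i (EuclideanSpace.single 0 1) : Fin N → E2) ∈ s := by rw [h]; trivial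
    simp only [s, LinearMap.mem_ker, LinearMap.sub_apply, LinearMap.proj_apply, Pi.single_eq_same,
      Pi.single_eq_of_ne (Ne.symm hij), sub_zero] at h1
    have h2 := congrArg (fun z : E2 => z 0) h1
    simp at h2
  refine measure_mono_null ?_ (Measure.addHaar_submodule volume s hs)
  rintro y ⟨-, hy⟩
  simp [s, hy]

end sols

/-- almost sure global existence for α ∈ [0,1) under the generic
condition on the intensities. -/
theorem pv_almost_sure_global_existence
    (α : ℝ) (hα : α ∈ Set.Ico (0:ℝ) 1)
    (N : ℕ) (a : Fin N → ℝ) (ha : ∀ i, a i ≠ 0)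
    (hgen : ∀ P : Finset (Fin N), P.Nonempty → ∑ i ∈ P, a i ≠ 0) :
    ∃ Z : Set (Fin N → E2),
      MeasureTheory.volume Z = 0 ∧
      {y : Fin N → E2 | ∃ i j : Fin N, i ≠ j ∧ y i = y j} ⊆ Z ∧
      ∀ x0 : Fin N → E2, x0 ∉ Z → ∀ T > (0:ℝ),
        (∃ x : ℝ → Fin N → E2, IsPVSol' α a x0 T x) ∧
        (∀ x y : ℝ → Fin N → E2, IsPVSol' α a x0 T x → IsPVSol' α a x0 T y →
          ∀ t ∈ Set.Icc (0:ℝ) T, x t = y t) := by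
  let B : ℕ → Set (Fin N → E2) := fun n => {x | ‖x‖ ≤ (n:ℝ) ∧
    (∀ i j, i ≠ j → 1 / ((n:ℝ) + 1) ≤ ‖x i - x j‖ ^ 2) ∧ ¬ ∃ y, IsPVSol' α a x (n:ℝ) y}
  refine ⟨{y : Fin N → E2 | ∃ i j : Fin N, i ≠ j ∧ y i = y j} ∪ ⋃ n, B n, ?_,
    Set.subset_union_left, ?_⟩
  · refine measure_union_null (pv_diag_null N) (measure_iUnion_null fun n => ?_)
    exact pv_bad_null hα.1 hα.2 a hgen n (1 / ((n:ℝ) + 1)) n (by positivity) (by positivity)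
  · intro x0 hx0 T hT
    refine ⟨?_, fun x y hx hy => pv_unique hα.1 hT.le hx hy⟩
    have hdist : ∀ i j, i ≠ j → x0 i ≠ x0 j := fun i j hij h =>
      hx0 (Or.inl ⟨i, j, hij, h⟩)
    have hev : ∀ᶠ n : ℕ in Filter.atTop, ∀ i j, i ≠ j → 1 / ((n:ℝ) + 1) ≤ ‖x0 i - x0 j‖ ^ 2 := by
      rw [Filter.eventually_all]; intro i
      rw [Filter.eventually_all]; intro j
      rw [Filter.eventually_imp_distrib_left]; intro hij
      have hp : 0 < ‖x0 i - x0 j‖ ^ 2 := by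
        have := norm_pos_iff.2 (sub_ne_zero.2 (hdist i j hij))
        positivity
      exact tendsto_one_div_add_atTop_nhds_zero_nat.eventually (Iic_mem_nhds hp)
    obtain ⟨n, ⟨h1, h2⟩, h3⟩ := ((hev.and
      (tendsto_natCast_atTop_atTop.eventually_ge_atTop ‖x0‖)).and
      (tendsto_natCast_atTop_atTop.eventually_ge_atTop T)).exists
    have hsol : ∃ y, IsPVSol' α a x0 (n:ℝ) y := by
      by_contra hno
      exact hx0 (Or.inr (Set.mem_iUnion.2 ⟨n, h2, h1, hno⟩))
    obtain ⟨y, hy1, hy2, hy3⟩ := hsol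
    have hsub : Set.Icc (0:ℝ) T ⊆ Set.Icc 0 (n:ℝ) := Set.Icc_subset_Icc_right h3
    exact ⟨y, hy1.mono hsub, fun t ht => hy2 t (hsub ht), fun i t ht => hy3 i t (hsub ht)⟩
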